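/- arXiv:math/0510550 — 3 statements merged into one kernel-verified Lean document; each statement's English description precedes it below -/
import Mathlib

section
/- Let V : ℝ → [0,∞) be continuous, not identically zero, with ∫_ℝ (1+|x|) V(x) dx < ∞. Then there exists a unique C² function φ_V : ℝ → (0,∞) satisfying the Sturm–Liouville equation φ_V''(x) = V(x) φ_V(x) for all x ∈ ℝ together with the boundary conditions lim_{x→+∞} φ_V'(x) = √(2/π) and lim_{x→−∞} φ_V'(x) = −√(2/π). Moreover φ_V is convex, φ_V(x)/|x| → √(2/π) as |x| → ∞, and there is a constant C with φ_V(x) ≤ C(1+|x|) for all x. -/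
open Filter Topology MeasureTheory

lemma hasDerivAt_Iic {g : ℝ → ℝ} (hg : Continuous g) (hi : ∀ x, IntegrableOn g (Set.Iic x)) (x : ℝ) :
    HasDerivAt (fun x => ∫ t in Set.Iic x, g t) (g x) x := by
  have h1 : (fun x => ∫ t in Set.Iic x, g t) = fun x => (∫ t in Set.Iic 0, g t) + ∫ t in (0:ℝ)..x, g t := by
    funext y
    rw [← intervalIntegral.integral_Iic_sub_Iic (hi 0) (hi y)]; ring
  rw [h1]
  exact (intervalIntegral.integral_hasDerivAt_right (hg.intervalIntegrable _ _)
    hg.stronglyMeasurable.stronglyMeasurableAtFilter hg.continuousAt).const_add _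

lemma tendsto_Iic_atTop {g : ℝ → ℝ} (hi : Integrable g) :
    Tendsto (fun x => ∫ t in Set.Iic x, g t) atTop (𝓝 (∫ t, g t)) :=
  (aecover_Iic tendsto_id).integral_tendsto_of_countably_generated hi

lemma tendsto_Iic_atBot {g : ℝ → ℝ} (hi : Integrable g) :
    Tendsto (fun x => ∫ t in Set.Iic x, g t) atBot (𝓝 0) := by
  have h := (aecover_Ioi (μ := volume) (tendsto_id (α := ℝ) (x := atBot))).integral_tendsto_of_countably_generated hi
  have h2 := (tendsto_const_nhds (x := ∫ t, g t)).sub h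
  rw [sub_self] at h2
  refine h2.congr fun x => ?_
  have := integral_add_compl (μ := volume) (f := g) (s := Set.Iic x) measurableSet_Iic hi
  rw [Set.compl_Iic] at this
  simp only [id]
  linarith

/-- The operator `J h x = ∫_{-∞}^x (x-t) V h`. -/
noncomputable def slJ (V h : ℝ → ℝ) (x : ℝ) : ℝ := ∫ t in Set.Iic x, (x - t) * (V t * h t)

lemma sl_int {V : ℝ → ℝ} (hVc : Continuous V) (hVpos : ∀ x, 0 ≤ V x)
    (hVint : Integrable (fun x => (1 + |x|) * V x)) {h : ℝ → ℝ} (hc : Continuous h) {B : ℝ} (hB : ∀ t, |h t| ≤ B * (1 + max t 0)) :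
    Integrable (fun t => V t * h t) := by
  have hB0 : 0 ≤ B := by have := (abs_nonneg _).trans (hB 0); simpa using this
  refine (hVint.const_mul B).mono' (hVc.mul hc).aestronglyMeasurable (ae_of_all _ fun t => ?_)
  rw [Real.norm_eq_abs, abs_mul, abs_of_nonneg (hVpos t)]
  have h1 : max t 0 ≤ |t| := max_le (le_abs_self t) (abs_nonneg t)
  calc V t * |h t| ≤ V t * (B * (1 + |t|)) := by
        refine mul_le_mul_of_nonneg_left ((hB t).trans ?_) (hVpos t)
        gcongr
    _ = _ := by ring

lemma sl_int2 {V : ℝ → ℝ} (hVc : Continuous V) (hVpos : ∀ x, 0 ≤ V x)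
    (hVint : Integrable (fun x => (1 + |x|) * V x)) {h : ℝ → ℝ} (hc : Continuous h) {B : ℝ} (hB : ∀ t, |h t| ≤ B * (1 + max t 0)) (x : ℝ) :
    IntegrableOn (fun t => t * (V t * h t)) (Set.Iic x) := by
  have hB0 : 0 ≤ B := by have := (abs_nonneg _).trans (hB 0); simpa using this
  refine ((hVint.const_mul (B * (1 + max x 0))).integrableOn (s := Set.Iic x)).mono'
    (continuous_id.mul (hVc.mul hc)).aestronglyMeasurable ?_
  refine (ae_restrict_mem measurableSet_Iic).mono fun t ht => ?_
  rw [Real.norm_eq_abs, abs_mul, abs_mul, abs_of_nonneg (hVpos t)]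
  have h1 : max t 0 ≤ max x 0 := max_le_max ht le_rfl
  have h2 : |h t| ≤ B * (1 + max x 0) := (hB t).trans (by gcongr)
  calc |t| * (V t * |h t|) ≤ (1 + |t|) * (V t * (B * (1 + max x 0))) := by
        have := hVpos t
        have : |t| ≤ 1 + |t| := by linarith
        gcongr
    _ = _ := by ring

lemma slJ_eq {V : ℝ → ℝ} (hVc : Continuous V) (hVpos : ∀ x, 0 ≤ V x)
    (hVint : Integrable (fun x => (1 + |x|) * V x)) {h : ℝ → ℝ} (hc : Continuous h) {B : ℝ} (hB : ∀ t, |h t| ≤ B * (1 + max t 0)) (x : ℝ) :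
    slJ V h x = x * (∫ t in Set.Iic x, V t * h t) - ∫ t in Set.Iic x, t * (V t * h t) := by
  rw [slJ, ← integral_const_mul, ← integral_sub
    ((sl_int hVc hVpos hVint hc hB).integrableOn.const_mul x) (sl_int2 hVc hVpos hVint hc hB x)]
  congr 1; funext t; ring

lemma slJ_integrand {V : ℝ → ℝ} (hVc : Continuous V) (hVpos : ∀ x, 0 ≤ V x)
    (hVint : Integrable (fun x => (1 + |x|) * V x)) {h : ℝ → ℝ} (hc : Continuous h) {B : ℝ} (hB : ∀ t, |h t| ≤ B * (1 + max t 0)) (x : ℝ) :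
    IntegrableOn (fun t => (x - t) * (V t * h t)) (Set.Iic x) := by
  refine (Integrable.sub
    ((sl_int hVc hVpos hVint hc hB).integrableOn.const_mul x) (sl_int2 hVc hVpos hVint hc hB x)).congr ?_
  refine ae_of_all _ fun t => ?_
  show x * (V t * h t) - t * (V t * h t) = (x - t) * (V t * h t)
  ring

lemma slJ_hasDerivAt {V : ℝ → ℝ} (hVc : Continuous V) (hVpos : ∀ x, 0 ≤ V x)
    (hVint : Integrable (fun x => (1 + |x|) * V x)) {h : ℝ → ℝ} (hc : Continuous h) {B : ℝ} (hB : ∀ t, |h t| ≤ B * (1 + max t 0)) (x : ℝ) :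
    HasDerivAt (slJ V h) (∫ t in Set.Iic x, V t * h t) x := by
  have e : slJ V h = fun x => x * (∫ t in Set.Iic x, V t * h t) - ∫ t in Set.Iic x, t * (V t * h t) :=
    funext (slJ_eq hVc hVpos hVint hc hB)
  rw [e]
  have h1 := hasDerivAt_Iic (hVc.mul hc) (fun x => (sl_int hVc hVpos hVint hc hB).integrableOn) x
  have h2 := hasDerivAt_Iic (continuous_id.mul (hVc.mul hc)) (sl_int2 hVc hVpos hVint hc hB) x
  exact (((hasDerivAt_id x).mul h1).sub h2).congr_deriv (by simp)

lemma slJ_nonneg {V : ℝ → ℝ} (hVpos : ∀ x, 0 ≤ V x) {h : ℝ → ℝ} (hn : ∀ t, 0 ≤ h t) (x : ℝ) : 0 ≤ slJ V h x := by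
  refine setIntegral_nonneg measurableSet_Iic fun t ht => ?_
  exact mul_nonneg (sub_nonneg.2 ht) (mul_nonneg (hVpos t) (hn t))

/-- The weight. -/
lemma sl_weight {V : ℝ → ℝ} (hVc : Continuous V) (hVpos : ∀ x, 0 ≤ V x)
    (hVint : Integrable (fun x => (1 + |x|) * V x)) : ∃ ρ : ℝ → ℝ, Continuous ρ ∧ (∀ x, 1 ≤ ρ x) ∧
    (∃ B, ∀ t, ρ t ≤ B * (1 + max t 0)) ∧ ∀ x, slJ V ρ x ≤ ρ x / 2 := by
  set m : ℝ → ℝ := fun x => (1 + |x|) * V x with hm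
  have hmc : Continuous m := by fun_prop
  have hm0 : ∀ x, 0 ≤ m x := fun x => mul_nonneg (by positivity) (hVpos x)
  set W : ℝ → ℝ := fun x => ∫ t in Set.Iic x, m t with hW
  have hWd : ∀ x, HasDerivAt W (m x) x := hasDerivAt_Iic hmc fun x => hVint.integrableOn
  have hW0 : ∀ x, 0 ≤ W x := fun x => setIntegral_nonneg measurableSet_Iic fun t _ => hm0 t
  have hWM : ∀ x, W x ≤ ∫ t, m t := fun x => setIntegral_le_integral hVint (ae_of_all _ hm0)
  have hWbot : Tendsto W atBot (𝓝 0) := tendsto_Iic_atBot hVint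
  set M := ∫ t, m t
  set E : ℝ → ℝ := fun x => Real.exp (2 * W x) with hE
  have hEd : ∀ x, HasDerivAt E (2 * (m x * E x)) x := fun x => by
    convert ((hWd x).const_mul 2).exp using 1; simp only [hE]; ring
  have hEc : Continuous E := continuous_iff_continuousAt.2 fun x => (hEd x).continuousAt
  have hE1 : ∀ x, 1 ≤ E x := fun x => Real.one_le_exp (by linarith [hW0 x])
  have hEM : ∀ x, E x ≤ Real.exp (2 * M) := fun x => Real.exp_le_exp.2 (by linarith [hWM x])
  have hEbot : Tendsto E atBot (𝓝 1) := by
    have := (Real.continuous_exp.tendsto _).comp (hWbot.const_mul 2)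
    rw [mul_zero, Real.exp_zero] at this
    exact this
  have hmE : Integrable (fun t => m t * E t) := by
    refine (hVint.mul_const (Real.exp (2 * M))).mono' (hmc.mul hEc).aestronglyMeasurable
      (ae_of_all _ fun t => ?_)
    rw [Real.norm_eq_abs, abs_of_nonneg (mul_nonneg (hm0 t) (by linarith [hE1 t]))]
    exact mul_le_mul_of_nonneg_left (hEM t) (hm0 t)
  have hint : ∀ x, ∫ t in Set.Iic x, m t * E t = (E x - 1) / 2 := fun x => by
    have := integral_Iic_of_hasDerivAt_of_tendsto' (a := x) (fun y _ => hEd y)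
      ((hmE.const_mul 2).integrableOn) hEbot
    rw [integral_const_mul] at this
    linarith
  have hρc : Continuous (fun x => (1 + max x 0) * E x) := by fun_prop
  have hB : ∀ t, (1 + max t 0) * E t ≤ Real.exp (2 * M) * (1 + max t 0) := fun t => by
    rw [mul_comm]; exact mul_le_mul_of_nonneg_right (hEM t) (by positivity)
  refine ⟨fun x => (1 + max x 0) * E x, hρc, fun x => ?_, ⟨_, hB⟩, fun x => ?_⟩
  · have : 0 ≤ max x 0 := le_max_right _ _
    nlinarith [hE1 x]
  · have hB' : ∀ t, |(1 + max t 0) * E t| ≤ Real.exp (2 * M) * (1 + max t 0) := fun t => by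
      rw [abs_of_nonneg]; exact hB t
      have := hE1 t
      positivity
    calc slJ V (fun x => (1 + max x 0) * E x) x
        ≤ ∫ t in Set.Iic x, (1 + max x 0) * (m t * E t) := by
          refine setIntegral_mono_on (slJ_integrand hVc hVpos hVint hρc hB' x)
            (hmE.const_mul _).integrableOn measurableSet_Iic fun t ht => ?_
          have hVE : 0 ≤ V t * E t := mul_nonneg (hVpos t) (by linarith [hE1 t])
          have key : (x - t) * (1 + max t 0) ≤ (1 + max x 0) * (1 + |t|) := by
            have ht' : t ≤ x := ht
            rcases le_total 0 t with h0 | h0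
            · rw [max_eq_left h0, abs_of_nonneg h0, max_eq_left (h0.trans ht')]
              nlinarith
            · rw [max_eq_right h0, abs_of_nonpos h0]
              have : x ≤ max x 0 := le_max_left _ _
              have : 0 ≤ max x 0 := le_max_right _ _
              nlinarith
          calc (x - t) * (V t * ((1 + max t 0) * E t))
              = (x - t) * (1 + max t 0) * (V t * E t) := by ring
            _ ≤ (1 + max x 0) * (1 + |t|) * (V t * E t) := mul_le_mul_of_nonneg_right key hVE
            _ = _ := by simp only [hm]; ring
      _ = (1 + max x 0) * ((E x - 1) / 2) := by rw [integral_const_mul, hint]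
      _ ≤ _ := by
          have : 0 ≤ max x 0 := le_max_right _ _
          simp only
          nlinarith

/-- Existence of the Jost solution via contraction. -/
lemma sl_fixed {V : ℝ → ℝ} (hVc : Continuous V) (hVpos : ∀ x, 0 ≤ V x)
    (hVint : Integrable (fun x => (1 + |x|) * V x)) : ∃ u : ℝ → ℝ, Continuous u ∧ (∃ B, ∀ t, |u t| ≤ B * (1 + max t 0)) ∧
    (∀ x, 0 ≤ u x) ∧ ∀ x, u x = 1 + slJ V u x := by
  obtain ⟨ρ, hρc, hρ1, ⟨B, hB⟩, hJ⟩ := sl_weight hVc hVpos hVint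
  have hρ0 : ∀ x, 0 < ρ x := fun x => by linarith [hρ1 x]
  have hρB : ∀ t, |ρ t| ≤ B * (1 + max t 0) := fun t => by rw [abs_of_pos (hρ0 t)]; exact hB t
  have hb : ∀ g : BoundedContinuousFunction ℝ ℝ, ∀ t, |ρ t * g t| ≤ (‖g‖ * B) * (1 + max t 0) := by
    intro g t
    rw [abs_mul, abs_of_pos (hρ0 t), mul_comm, mul_assoc]
    exact mul_le_mul (g.norm_coe_le_norm t) (hB t) (hρ0 t).le (norm_nonneg g)
  have hgc : ∀ g : BoundedContinuousFunction ℝ ℝ, Continuous fun t => ρ t * g t :=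
    fun g => hρc.mul g.continuous
  have hest : ∀ h : ℝ → ℝ, ∀ K : ℝ, (∀ t, |h t| ≤ K * ρ t) →
      ∀ x, |slJ V h x| ≤ K * (ρ x / 2) := by
    intro h K hK x
    have h1 : ‖slJ V h x‖ ≤ ∫ t in Set.Iic x, K * ((x - t) * (V t * ρ t)) := by
      refine norm_integral_le_of_norm_le
        ((slJ_integrand hVc hVpos hVint hρc hρB x).const_mul K) ?_
      refine (ae_restrict_mem measurableSet_Iic).mono fun t ht => ?_
      have ht' : 0 ≤ x - t := sub_nonneg.2 ht
      rw [Real.norm_eq_abs, abs_mul, abs_mul, abs_of_nonneg ht', abs_of_nonneg (hVpos t)]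
      calc (x - t) * (V t * |h t|) ≤ (x - t) * (V t * (K * ρ t)) := by
            have := hVpos t
            have := hK t
            gcongr
        _ = _ := by ring
    rw [integral_const_mul] at h1
    refine h1.trans (mul_le_mul_of_nonneg_left (hJ x) ?_)
    have := (abs_nonneg _).trans (hK 0)
    exact nonneg_of_mul_nonneg_left this (hρ0 0)
  have hJc : ∀ g : BoundedContinuousFunction ℝ ℝ, Continuous (slJ V fun t => ρ t * g t) := fun g =>
    continuous_iff_continuousAt.2 fun x =>
      (slJ_hasDerivAt hVc hVpos hVint (hgc g) (hb g) x).continuousAt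
  have hgn : ∀ g : BoundedContinuousFunction ℝ ℝ, ∀ t, |ρ t * g t| ≤ ‖g‖ * ρ t := fun g t => by
    rw [abs_mul, abs_of_pos (hρ0 t), mul_comm]
    exact mul_le_mul_of_nonneg_right (g.norm_coe_le_norm t) (hρ0 t).le
  let T : BoundedContinuousFunction ℝ ℝ → BoundedContinuousFunction ℝ ℝ := fun g =>
    BoundedContinuousFunction.ofNormedAddCommGroup (fun x => (1 + slJ V (fun t => ρ t * g t) x) / ρ x)
      ((continuous_const.add (hJc g)).div hρc fun x => (hρ0 x).ne') (1 + ‖g‖) (fun x => by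
        rw [Real.norm_eq_abs, abs_div, abs_of_pos (hρ0 x), div_le_iff₀ (hρ0 x)]
        have h1 := hest _ _ (hgn g) x
        have h2 := abs_add_le 1 (slJ V (fun t => ρ t * g t) x)
        rw [abs_one] at h2
        have := mul_nonneg (norm_nonneg g) (hρ0 x).le
        linarith [hρ1 x])
  have hT : ∀ g x, T g x = (1 + slJ V (fun t => ρ t * g t) x) / ρ x := fun g x => rfl
  have hcontr : ContractingWith (1/2) T := by
    refine ⟨by norm_num, LipschitzWith.of_dist_le_mul fun g₁ g₂ => ?_⟩
    rw [BoundedContinuousFunction.dist_le (by positivity)]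
    intro x
    rw [Real.dist_eq, hT, hT, ← sub_div, abs_div, abs_of_pos (hρ0 x), div_le_iff₀ (hρ0 x)]
    have e : slJ V (fun t => ρ t * g₁ t) x - slJ V (fun t => ρ t * g₂ t) x
        = slJ V (fun t => ρ t * (g₁ - g₂) t) x := by
      rw [slJ, slJ, slJ, ← integral_sub (slJ_integrand hVc hVpos hVint (hgc g₁) (hb g₁) x)
        (slJ_integrand hVc hVpos hVint (hgc g₂) (hb g₂) x)]
      congr 1; funext t
      simp only [BoundedContinuousFunction.coe_sub, Pi.sub_apply]; ring
    have h1 := hest _ _ (hgn (g₁ - g₂)) x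
    rw [add_sub_add_left_eq_sub, e, dist_eq_norm]
    refine h1.trans (le_of_eq ?_)
    push_cast; ring
  have hfix := hcontr.fixedPoint_isFixedPt
  set g := ContractingWith.fixedPoint T hcontr with hg
  have hpos : ∀ x, 0 ≤ g x := by
    intro x
    have ht := hcontr.tendsto_iterate_fixedPoint 0
    have ht2 : Tendsto (fun n => (T^[n] 0) x) atTop (𝓝 (g x)) :=
      ((continuous_eval_const (F := BoundedContinuousFunction ℝ ℝ) x).tendsto _).comp ht
    refine ge_of_tendsto' ht2 fun n => ?_
    have : ∀ n, ∀ x, 0 ≤ (T^[n] 0) x := by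
      intro n
      induction n with
      | zero => intro x; simp
      | succ n ih =>
        intro x
        rw [Function.iterate_succ_apply', hT]
        have := slJ_nonneg hVpos (h := fun t => ρ t * (T^[n] 0) t) (fun t => mul_nonneg (hρ0 t).le (ih t)) x
        have := hρ0 x
        positivity
    exact this n x
  refine ⟨fun t => ρ t * g t, hgc g, ⟨_, hb g⟩, fun x => mul_nonneg (hρ0 x).le (hpos x), fun x => ?_⟩
  have h1 : T g x = g x := by rw [hfix.eq]
  rw [hT, div_eq_iff (hρ0 x).ne'] at h1
  simp only
  rw [mul_comm, ← h1]

lemma sl_jost {V : ℝ → ℝ} (hVc : Continuous V) (hVpos : ∀ x, 0 ≤ V x)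
    (hVint : Integrable (fun x => (1 + |x|) * V x)) (hVne : ∃ x, V x ≠ 0) : ∃ u u' : ℝ → ℝ, (∀ x, HasDerivAt u (u' x) x) ∧
    (∀ x, HasDerivAt u' (V x * u x) x) ∧ (∀ x, 0 < u x) ∧ Tendsto u' atBot (𝓝 0) ∧
    ∃ a, 0 < a ∧ Tendsto u' atTop (𝓝 a) := by
  obtain ⟨u, hc, ⟨B, hB⟩, h0, hu⟩ := sl_fixed hVc hVpos hVint
  have hi := sl_int hVc hVpos hVint hc hB
  have hu1 : ∀ x, 0 < u x := fun x => by
    rw [hu]; linarith [slJ_nonneg hVpos h0 x]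
  refine ⟨u, fun x => ∫ t in Set.Iic x, V t * u t, fun x => ?_, 
    hasDerivAt_Iic (hVc.mul hc) fun x => hi.integrableOn, hu1, tendsto_Iic_atBot hi,
    _, ?_, tendsto_Iic_atTop hi⟩
  · have := (slJ_hasDerivAt hVc hVpos hVint hc hB x).const_add 1
    rwa [← (funext hu : u = fun x => 1 + slJ V u x)] at this
  · obtain ⟨x, hx⟩ := hVne
    exact integral_pos_of_integrable_nonneg_nonzero (x := x) (hVc.mul hc) hi
      (fun t => mul_nonneg (hVpos t) (h0 t)) (mul_ne_zero hx (hu1 x).ne')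

lemma sl_div_tendsto {f f' : ℝ → ℝ} {s : ℝ} (hf : ∀ x, HasDerivAt f (f' x) x)
    (hs : Tendsto f' atTop (𝓝 s)) : Tendsto (fun x => f x / |x|) atTop (𝓝 s) := by
  rw [Metric.tendsto_atTop]
  intro ε hε
  obtain ⟨N, hN⟩ := Metric.tendsto_atTop.1 hs (ε / 3) (by positivity)
  set c := f N - s * N with hcdef
  have key : ∀ x, N ≤ x → |(f x - s * x) - c| ≤ ε / 3 * |x - N| := by
    intro x hx
    have := (convex_Ici N).norm_image_sub_le_of_norm_hasDerivWithin_le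
      (f := fun x => f x - s * x) (f' := fun x => f' x - s) (C := ε / 3) (x := N) (y := x)
      (fun y _ => ((hf y).sub (by simpa using (hasDerivAt_id y).const_mul s)).hasDerivWithinAt)
      (fun y hy => by have := hN y hy; rw [Real.dist_eq] at this; exact this.le)
      Set.self_mem_Ici hx
    simpa [Real.norm_eq_abs] using this
  refine ⟨max (max N 1) (max (|N| + 1) (3 * |c| / ε + 1)), fun x hx => ?_⟩
  have hxN : N ≤ x := (le_max_left _ _).trans ((le_max_left _ _).trans hx)
  have hx1 : 1 ≤ x := (le_max_right _ _).trans ((le_max_left _ _).trans hx)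
  have hx2 : |N| + 1 ≤ x := (le_max_left _ _).trans ((le_max_right _ _).trans hx)
  have hx3 : 3 * |c| / ε + 1 ≤ x := (le_max_right _ _).trans ((le_max_right _ _).trans hx)
  have hx0 : 0 < x := by linarith
  have h3 : 3 * |c| < ε * x := by
    have : 3 * |c| / ε < x := by linarith
    rw [div_lt_iff₀ hε] at this; linarith
  have h4 : |x - N| ≤ 2 * x := by
    rw [abs_of_nonneg (by linarith)]; linarith [neg_abs_le N]
  have h5 := key x hxN
  have h6 : |f x - s * x| ≤ |c| + ε / 3 * (2 * x) := by
    have := abs_sub_abs_le_abs_sub (f x - s * x) c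
    have : ε / 3 * |x - N| ≤ ε / 3 * (2 * x) := by gcongr
    linarith
  rw [Real.dist_eq, abs_of_pos hx0, div_sub' hx0.ne', abs_div, abs_of_pos hx0, div_lt_iff₀ hx0, mul_comm x s]
  linarith

/-- Uniqueness. -/
lemma sl_unique {V : ℝ → ℝ} (hVpos : ∀ x, 0 ≤ V x) (hVne : ∃ x, V x ≠ 0) {w w' : ℝ → ℝ}
    (h1 : ∀ x, HasDerivAt w (w' x) x) (h2 : ∀ x, HasDerivAt w' (V x * w x) x)
    (ht : Tendsto w' atTop (𝓝 0)) (hb : Tendsto w' atBot (𝓝 0)) : ∀ x, w x = 0 := by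
  have hp : ∀ x, HasDerivAt (fun x => w x * w' x) (w' x * w' x + w x * (V x * w x)) x :=
    fun x => (h1 x).mul (h2 x)
  have hmono : Monotone (fun x => w x * w' x) := monotone_of_hasDerivAt_nonneg hp fun x => by
    have := mul_nonneg (hVpos x) (mul_self_nonneg (w x))
    simp only [Pi.zero_apply]
    nlinarith [mul_self_nonneg (w' x)]
  have hq : ∀ x, HasDerivAt (fun x => w' x * w' x) (2 * (V x * (w x * w' x))) x := fun x => by
    exact ((h2 x).mul (h2 x)).congr_deriv (by ring)
  have hqc : Continuous (fun x => w' x * w' x) := continuous_iff_continuousAt.2 fun x => (hq x).continuousAt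
  have hprod : ∀ x, w x * w' x = 0 := by
    intro x0
    rcases lt_trichotomy (w x0 * w' x0) 0 with hneg | h0 | hpos
    · exfalso
      have hanti : AntitoneOn (fun x => w' x * w' x) (Set.Iic x0) := by
        refine antitoneOn_of_hasDerivWithinAt_nonpos (convex_Iic x0) hqc.continuousOn
          (fun x _ => (hq x).hasDerivWithinAt) fun x hx => ?_
        rw [interior_Iic] at hx
        have := hmono (le_of_lt hx)
        simp only at this
        nlinarith [hVpos x]
      have hlim : Tendsto (fun x => w' x * w' x) atBot (𝓝 0) := by simpa using hb.mul hb
      have : w' x0 * w' x0 ≤ 0 := ge_of_tendsto hlim (by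
        filter_upwards [eventually_le_atBot x0] with x hx
        exact hanti (Set.mem_Iic.2 hx) Set.self_mem_Iic hx)
      have : w' x0 = 0 := mul_self_eq_zero.1 (le_antisymm this (mul_self_nonneg _))
      simp [this] at hneg
    · exact h0
    · exfalso
      have hanti : MonotoneOn (fun x => w' x * w' x) (Set.Ici x0) := by
        refine monotoneOn_of_hasDerivWithinAt_nonneg (convex_Ici x0) hqc.continuousOn
          (fun x _ => (hq x).hasDerivWithinAt) fun x hx => ?_
        rw [interior_Ici] at hx
        have := hmono (le_of_lt hx)
        simp only at this
        have := hVpos x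
        have : 0 ≤ w x * w' x := by linarith
        positivity
      have hlim : Tendsto (fun x => w' x * w' x) atTop (𝓝 0) := by simpa using ht.mul ht
      have : w' x0 * w' x0 ≤ 0 := ge_of_tendsto hlim (by
        filter_upwards [eventually_ge_atTop x0] with x hx
        exact hanti Set.self_mem_Ici (Set.mem_Ici.2 hx) hx)
      have : w' x0 = 0 := mul_self_eq_zero.1 (le_antisymm this (mul_self_nonneg _))
      simp [this] at hpos
  have hz : ∀ x, w' x * w' x + w x * (V x * w x) = 0 := fun x => by
    have e : (fun x => w x * w' x) = fun _ => (0:ℝ) := funext hprod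
    have := hp x
    rw [e] at this
    exact this.unique (hasDerivAt_const x 0)
  have hw' : ∀ x, w' x = 0 := fun x => by
    have := mul_nonneg (hVpos x) (mul_self_nonneg (w x))
    have := hz x
    exact mul_self_eq_zero.1 (le_antisymm (by nlinarith) (mul_self_nonneg _))
  obtain ⟨x1, hx1⟩ := hVne
  have hw1 : w x1 = 0 := by
    have := hz x1
    rw [hw' x1] at this
    simpa [hx1] using this
  intro x
  rw [← hw1]
  exact is_const_of_deriv_eq_zero (fun x => (h1 x).differentiableAt) (fun x => by rw [(h1 x).deriv, hw']) x x1

theorem sturmLiouville_integrable_case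
    (V : ℝ → ℝ) (hVc : Continuous V) (hVpos : ∀ x, 0 ≤ V x)
    (hVne : ∃ x, V x ≠ 0)
    (hVint : Integrable (fun x => (1 + |x|) * V x)) :
    ∃ φ : ℝ → ℝ,
      ((∀ x, 0 < φ x) ∧ ContDiff ℝ 2 φ ∧
        (∀ x, deriv (deriv φ) x = V x * φ x) ∧
        Tendsto (deriv φ) atTop (𝓝 (Real.sqrt (2 / Real.pi))) ∧
        Tendsto (deriv φ) atBot (𝓝 (-Real.sqrt (2 / Real.pi)))) ∧
      (∀ ψ : ℝ → ℝ,
        ((∀ x, 0 < ψ x) ∧ ContDiff ℝ 2 ψ ∧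
          (∀ x, deriv (deriv ψ) x = V x * ψ x) ∧
          Tendsto (deriv ψ) atTop (𝓝 (Real.sqrt (2 / Real.pi))) ∧
          Tendsto (deriv ψ) atBot (𝓝 (-Real.sqrt (2 / Real.pi)))) → ψ = φ) ∧
      ConvexOn ℝ Set.univ φ ∧
      Tendsto (fun x => φ x / |x|) atTop (𝓝 (Real.sqrt (2 / Real.pi))) ∧
      Tendsto (fun x => φ x / |x|) atBot (𝓝 (Real.sqrt (2 / Real.pi))) ∧
      ∃ C : ℝ, ∀ x, φ x ≤ C * (1 + |x|) := by
  have hs : 0 < Real.sqrt (2 / Real.pi) := Real.sqrt_pos.2 (by positivity)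
  set s := Real.sqrt (2 / Real.pi)
  obtain ⟨u, u', hu, hu', hu0, hub, a, ha, hut⟩ := sl_jost hVc hVpos hVint hVne
  obtain ⟨v, v', hv, hv', hv0, hvb, b, hb, hvt⟩ := sl_jost (V := fun x => V (-x))
    (hVc.comp continuous_neg) (fun x => hVpos _)
    (by simpa using hVint.comp_neg) (by
      obtain ⟨x, hx⟩ := hVne
      exact ⟨-x, by simpa using hx⟩)
  set φ : ℝ → ℝ := fun x => s / a * u x + s / b * v (-x) with hφ
  set φ' : ℝ → ℝ := fun x => s / a * u' x - s / b * v' (-x) with hφ'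
  have d1 : ∀ x, HasDerivAt φ (φ' x) x := fun x => by
    exact (((hu x).const_mul (s / a)).add
      (((hv (-x)).comp x (hasDerivAt_neg x)).const_mul (s / b))).congr_deriv (by
        simp only [hφ']; ring)
  have d2 : ∀ x, HasDerivAt φ' (V x * φ x) x := fun x => by
    exact (((hu' x).const_mul (s / a)).sub
      (((hv' (-x)).comp x (hasDerivAt_neg x)).const_mul (s / b))).congr_deriv (by
        simp only [hφ, neg_neg]; ring)
  have hpos : ∀ x, 0 < φ x := fun x => by
    have := hu0 x
    have := hv0 (-x)
    positivity
  have e1 : deriv φ = φ' := funext fun x => (d1 x).deriv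
  have e2 : deriv φ' = fun x => V x * φ x := funext fun x => (d2 x).deriv
  have tt : Tendsto φ' atTop (𝓝 s) := by
    have := (hut.const_mul (s / a)).sub ((hvb.comp tendsto_neg_atTop_atBot).const_mul (s / b))
    rwa [mul_zero, sub_zero, div_mul_cancel₀ _ ha.ne'] at this
  have tb : Tendsto φ' atBot (𝓝 (-s)) := by
    have := (hub.const_mul (s / a)).sub ((hvt.comp tendsto_neg_atBot_atTop).const_mul (s / b))
    rwa [mul_zero, zero_sub, div_mul_cancel₀ _ hb.ne'] at this
  have hφc : Continuous φ := continuous_iff_continuousAt.2 fun x => (d1 x).continuousAt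
  have hcd : ContDiff ℝ 2 φ := by
    rw [show (2 : WithTop ℕ∞) = 1 + 1 by norm_num, contDiff_succ_iff_deriv]
    refine ⟨fun x => (d1 x).differentiableAt, by simp, ?_⟩
    rw [e1, contDiff_one_iff_deriv, e2]
    exact ⟨fun x => (d2 x).differentiableAt, hVc.mul hφc⟩
  have hmono : Monotone φ' := monotone_of_hasDerivAt_nonneg d2 fun x =>
    mul_nonneg (hVpos x) (hpos x).le
  have hup : ∀ x, φ' x ≤ s := fun x => hmono.ge_of_tendsto tt x
  have hlow : ∀ x, -s ≤ φ' x := fun x => hmono.le_of_tendsto tb x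
  refine ⟨φ, ⟨hpos, hcd, ?_, ?_, ?_⟩, ?_, ?_, sl_div_tendsto d1 tt, ?_, ?_⟩
  · intro x; rw [e1, e2]
  · rwa [e1]
  · rwa [e1]
  · rintro ψ ⟨-, hψc, hψ, hψt, hψb⟩
    rw [show (2 : WithTop ℕ∞) = 1 + 1 by norm_num, contDiff_succ_iff_deriv] at hψc
    have f1 : ∀ x, HasDerivAt ψ (deriv ψ x) x := fun x => (hψc.1 x).hasDerivAt
    have f2 : ∀ x, HasDerivAt (deriv ψ) (V x * ψ x) x := fun x => by
      rw [← hψ x]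
      exact (hψc.2.2.differentiable (by norm_num) x).hasDerivAt
    funext x
    refine sub_eq_zero.1 (sl_unique hVpos hVne (w := fun x => ψ x - φ x)
      (w' := fun x => deriv ψ x - φ' x) (fun x => (f1 x).sub (d1 x)) (fun x => ?_) ?_ ?_ x)
    · exact ((f2 x).sub (d2 x)).congr_deriv (by ring)
    · simpa using hψt.sub tt
    · simpa using hψb.sub tb
  · refine MonotoneOn.convexOn_of_deriv convex_univ hφc.continuousOn
      (fun x _ => (d1 x).differentiableAt.differentiableWithinAt) ?_
    rw [e1]; exact hmono.monotoneOn _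
  · have h := sl_div_tendsto (f := fun x => φ (-x)) (f' := fun x => -φ' (-x)) (s := s) (fun x => by
      exact ((d1 (-x)).comp x (hasDerivAt_neg x)).congr_deriv (by ring)) (by
      simpa using (tb.comp tendsto_neg_atTop_atBot).neg)
    have := h.comp tendsto_neg_atBot_atTop
    refine this.congr fun x => ?_
    simp
  · refine ⟨φ 0 + s, fun x => ?_⟩
    have := convex_univ.norm_image_sub_le_of_norm_hasDerivWithin_le
      (f := φ) (f' := φ') (C := s) (x := 0) (y := x)
      (fun y _ => (d1 y).hasDerivWithinAt)
      (fun y _ => abs_le.2 ⟨hlow y, hup y⟩) (Set.mem_univ _) (Set.mem_univ _)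
    rw [sub_zero, Real.norm_eq_abs, Real.norm_eq_abs] at this
    have h2 := le_abs_self (φ x - φ 0)
    nlinarith [abs_nonneg x, hpos 0, mul_nonneg (hpos 0).le (abs_nonneg x)]
end

section
/- Let μ ≥ −1/2 and λ > 0, and set n_μ = (−μ + √(μ² + λ))/2. Then there exists a unique function φ : [0,∞) → ℝ which is C¹ on [0,∞) with φ'(0) = 0, C² on (0,∞), satisfies (1/2)φ''(x) + ((2μ+1)/(2x)) φ'(x) = (λ/2) · φ(x)/(1+x²) for all x > 0, and satisfies φ(x)/x^{2n_μ} → 1 as x → ∞. Moreover this function φ is strictly positive on [0,∞). -/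
open Filter Topology

/-- The property of being the normalized solution of the Bessel-type Sturm–Liouville
equation `(1/2)φ'' + ((2μ+1)/(2x))φ' = (λ/2)φ/(1+x²)` on `(0,∞)`, `C¹` up to `0` with
`φ'(0) = 0` and `φ(x) ~ x^{2n}` at infinity. -/
def IsCriticalSLSolution (μ lam n : ℝ) (φ : ℝ → ℝ) : Prop :=
  ContDiffOn ℝ 1 φ (Set.Ici 0) ∧
  derivWithin φ (Set.Ici 0) 0 = 0 ∧
  ContDiffOn ℝ 2 φ (Set.Ioi 0) ∧
  (∀ x : ℝ, 0 < x →
    (1/2) * derivWithin (derivWithin φ (Set.Ici 0)) (Set.Ici 0) x +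
      ((2 * μ + 1) / (2 * x)) * derivWithin φ (Set.Ici 0) x =
        (lam / 2) * (φ x / (1 + x ^ 2))) ∧
  Tendsto (fun x : ℝ => φ x / x ^ (2 * n)) atTop (𝓝 1)


noncomputable def critHop (a : ℝ) (f : ℝ → ℝ) (t : ℝ) : ℝ :=
  ∫ r in (0:ℝ)..1, r ^ a * (f (r * t) / (1 + (r * t) ^ 2))

noncomputable def critTop (a L : ℝ) (f : ℝ → ℝ) (x : ℝ) : ℝ :=
  1 + x ^ 2 * ∫ s in (0:ℝ)..1, L * s * critHop a f (s * x)

noncomputable def critG (L x : ℝ) : ℝ := Real.exp (L * x ^ 2 / 2)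

noncomputable def critSeq (a L : ℝ) : ℕ → ℝ → ℝ
  | 0 => fun _ => 1
  | k + 1 => critTop a L (critSeq a L k)

lemma critInt_cont {a : ℝ} (ha : 0 ≤ a) {f : ℝ → ℝ} (hf : Continuous f) :
    Continuous (fun p : ℝ × ℝ => p.2 ^ a * (f (p.2 * p.1) / (1 + (p.2 * p.1) ^ 2))) := by
  refine Continuous.mul ?_ ?_
  · exact (Real.continuous_rpow_const ha).comp continuous_snd
  · refine Continuous.div (by fun_prop) (by fun_prop) (fun p => by positivity)

lemma critHop_cont {a : ℝ} (ha : 0 ≤ a) {f : ℝ → ℝ} (hf : Continuous f) :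
    Continuous (critHop a f) := by
  unfold critHop
  exact intervalIntegral.continuous_parametric_intervalIntegral_of_continuous'
    (f := fun t r => r ^ a * (f (r * t) / (1 + (r * t) ^ 2))) (critInt_cont ha hf) 0 1

lemma critTop_cont {a L : ℝ} (ha : 0 ≤ a) {f : ℝ → ℝ} (hf : Continuous f) :
    Continuous (critTop a L f) := by
  unfold critTop
  have h1 := critHop_cont ha hf
  have := intervalIntegral.continuous_parametric_intervalIntegral_of_continuous'
    (f := fun x s => L * s * critHop a f (s * x)) (μ := MeasureTheory.volume) (by
      simp only [Function.uncurry_def]; fun_prop) 0 1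
  fun_prop

lemma critHop_integrable {a : ℝ} (ha : 0 ≤ a) {f : ℝ → ℝ} (hf : Continuous f) (t : ℝ) :
    IntervalIntegrable (fun r : ℝ => r ^ a * (f (r * t) / (1 + (r * t) ^ 2)))
      MeasureTheory.volume 0 1 := by
  have : Continuous (fun r : ℝ => r ^ a * (f (r * t) / (1 + (r * t) ^ 2))) :=
    (critInt_cont ha hf).comp (f := fun r : ℝ => (t, r)) (by fun_prop)
  exact this.intervalIntegrable _ _

lemma critHop_mono {a : ℝ} (ha : 0 ≤ a) {f g : ℝ → ℝ} (hf : Continuous f) (hg : Continuous g)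
    (h : ∀ x, f x ≤ g x) (t : ℝ) : critHop a f t ≤ critHop a g t := by
  unfold critHop
  refine intervalIntegral.integral_mono_on (by norm_num) (critHop_integrable ha hf t)
    (critHop_integrable ha hg t) ?_
  intro r hr
  have := Real.rpow_nonneg hr.1 a
  have := h (r * t)
  gcongr

lemma critTop_mono {a L : ℝ} (ha : 0 ≤ a) (hL : 0 < L) {f g : ℝ → ℝ} (hf : Continuous f)
    (hg : Continuous g)
    (h : ∀ x, f x ≤ g x) (x : ℝ) : critTop a L f x ≤ critTop a L g x := by
  unfold critTop
  have h1 := critHop_cont ha hf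
  have h2 := critHop_cont ha hg
  have : ∫ s in (0:ℝ)..1, L * s * critHop a f (s * x) ≤
      ∫ s in (0:ℝ)..1, L * s * critHop a g (s * x) := by
    refine intervalIntegral.integral_mono_on (by norm_num)
      (Continuous.intervalIntegrable (by fun_prop) _ _)
      (Continuous.intervalIntegrable (by fun_prop) _ _) ?_
    intro s hs
    have := critHop_mono ha hf hg h (s * x)
    have := hs.1
    gcongr
  gcongr

lemma critG_cont (L : ℝ) : Continuous (critG L) := by unfold critG; fun_prop

lemma critG_le {L : ℝ} (hL : 0 < L) {r : ℝ} (hr : r ∈ Set.Icc (0:ℝ) 1) (t : ℝ) :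
    critG L (r * t) ≤ critG L t := by
  unfold critG
  have h1 : (r * t) ^ 2 ≤ t ^ 2 := by
    have : r ^ 2 ≤ 1 := pow_le_one₀ hr.1 hr.2
    rw [mul_pow]; nlinarith [sq_nonneg t]
  gcongr

lemma critBound {a L : ℝ} (ha : 0 ≤ a) (hL : 0 < L) {f : ℝ → ℝ} (h0 : ∀ x, 0 ≤ f x)
    (h : ∀ x, f x ≤ critG L x) (t : ℝ) {r : ℝ} (hr : r ∈ Set.Icc (0:ℝ) 1) :
    r ^ a * (f (r * t) / (1 + (r * t) ^ 2)) ≤ critG L t := by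
  have h1 : r ^ a ≤ 1 := Real.rpow_le_one hr.1 hr.2 ha
  have h2 := Real.rpow_nonneg hr.1 a
  have h3 : f (r * t) / (1 + (r * t) ^ 2) ≤ critG L t :=
    (div_le_self (h0 _) (by nlinarith [sq_nonneg (r * t)])).trans ((h _).trans (critG_le hL hr t))
  have h4 : 0 ≤ f (r * t) / (1 + (r * t) ^ 2) := div_nonneg (h0 _) (by positivity)
  nlinarith

lemma critHop_nonneg {a : ℝ} {f : ℝ → ℝ} (h0 : ∀ x, 0 ≤ f x) (t : ℝ) : 0 ≤ critHop a f t := by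
  unfold critHop
  refine intervalIntegral.integral_nonneg (by norm_num) (fun r hr => ?_)
  exact mul_nonneg (Real.rpow_nonneg hr.1 a) (div_nonneg (h0 _) (by positivity))

lemma critHop_le {a L : ℝ} (ha : 0 ≤ a) (hL : 0 < L) {f : ℝ → ℝ} (hf : Continuous f)
    (h0 : ∀ x, 0 ≤ f x)
    (h : ∀ x, f x ≤ critG L x) (t : ℝ) : critHop a f t ≤ critG L t := by
  unfold critHop
  have := intervalIntegral.integral_mono_on (by norm_num) (critHop_integrable ha hf t)
    (_root_.intervalIntegrable_const (c := critG L t)) (fun r hr => critBound ha hL h0 h t hr)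
  simpa using this

lemma critTop_ge {a L : ℝ} (hL : 0 < L) {f : ℝ → ℝ}
    (h0 : ∀ x, 0 ≤ f x) (x : ℝ) : 1 ≤ critTop a L f x := by
  unfold critTop
  have : 0 ≤ ∫ s in (0:ℝ)..1, L * s * critHop a f (s * x) := by
    refine intervalIntegral.integral_nonneg (by norm_num) (fun s hs => ?_)
    have := critHop_nonneg (a := a) h0 (s * x)
    have := hs.1
    positivity
  nlinarith [mul_nonneg (sq_nonneg x) this]

lemma critTop_le {a L : ℝ} (ha : 0 ≤ a) (hL : 0 < L) {f : ℝ → ℝ} (hf : Continuous f)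
    (h0 : ∀ x, 0 ≤ f x)
    (h : ∀ x, f x ≤ critG L x) (x : ℝ) : critTop a L f x ≤ critG L x := by
  unfold critTop
  have h1 := critHop_cont ha hf
  have h2 := critG_cont L
  have key : ∫ s in (0:ℝ)..1, L * s * critHop a f (s * x) ≤
      ∫ s in (0:ℝ)..1, L * s * critG L (s * x) := by
    refine intervalIntegral.integral_mono_on (by norm_num)
      (Continuous.intervalIntegrable (by fun_prop) _ _)
      (Continuous.intervalIntegrable (by fun_prop) _ _) ?_
    intro s hs
    have := critHop_le ha hL hf h0 h (s * x)
    have := hs.1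
    gcongr
  have h3 : ∫ s in (0:ℝ)..1, x ^ 2 * (L * s * critG L (s * x)) = critG L x - 1 := by
    rw [intervalIntegral.integral_eq_sub_of_hasDerivAt (f := fun s => critG L (s * x))]
    · simp [critG]
    · intro s _
      have : HasDerivAt (fun s : ℝ => L * (s * x) ^ 2 / 2) (L * (2 * (s * x) * x) / 2) s := by
        have := ((((hasDerivAt_id s).mul_const x).pow 2).const_mul L).div_const 2
        exact this.congr_deriv (by simp)
      exact this.exp.congr_deriv (by simp only [critG]; ring)
    · exact Continuous.intervalIntegrable (by fun_prop) _ _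
  rw [intervalIntegral.integral_const_mul] at h3
  nlinarith [mul_le_mul_of_nonneg_left key (sq_nonneg x)]

lemma critSeq_prop {a L : ℝ} (ha : 0 ≤ a) (hL : 0 < L) (k : ℕ) :
    Continuous (critSeq a L k) ∧ (∀ x, 1 ≤ critSeq a L k x) ∧ (∀ x, critSeq a L k x ≤ critG L x) := by
  induction k with
  | zero =>
    refine ⟨continuous_const, fun x => le_rfl, fun x => ?_⟩
    exact Real.one_le_exp (by positivity)
  | succ k ih =>
    obtain ⟨h1, h2, h3⟩ := ih
    have h0 : ∀ x, 0 ≤ critSeq a L k x := fun x => zero_le_one.trans (h2 x)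
    exact ⟨critTop_cont ha h1, critTop_ge hL h0, critTop_le ha hL h1 h0 h3⟩

lemma critSeq_mono {a L : ℝ} (ha : 0 ≤ a) (hL : 0 < L) (x : ℝ) :
    Monotone (fun k => critSeq a L k x) := by
  have : ∀ k x, critSeq a L k x ≤ critSeq a L (k+1) x := by
    intro k
    induction k with
    | zero => intro x; exact (critSeq_prop ha hL 1).2.1 x
    | succ k ih =>
      intro x
      exact critTop_mono ha hL (critSeq_prop ha hL k).1 (critSeq_prop ha hL (k+1)).1 ih x
  exact monotone_nat_of_le_succ (fun k => this k x)

lemma crit_fixed {a L : ℝ} (ha : 0 ≤ a) (hL : 0 < L) :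
    ∃ u : ℝ → ℝ, Continuous u ∧ (∀ x, 1 ≤ u x) ∧
      ∀ x, u x = 1 + ∫ t in (0:ℝ)..x, L * t * critHop a u t := by
  set g := critSeq a L with hg
  have hb : ∀ x, BddAbove (Set.range fun k => g k x) := fun x =>
    ⟨critG L x, by rintro _ ⟨k, rfl⟩; exact (critSeq_prop ha hL k).2.2 x⟩
  let u : ℝ → ℝ := fun x => ⨆ k, g k x
  have hlim : ∀ x, Tendsto (fun k => g k x) atTop (𝓝 (u x)) := fun x =>
    tendsto_atTop_ciSup (critSeq_mono ha hL x) (hb x)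
  have hu1 : ∀ x, 1 ≤ u x := fun x => ge_of_tendsto' (hlim x) (fun k => (critSeq_prop ha hL k).2.1 x)
  have huG : ∀ x, u x ≤ critG L x := fun x =>
    le_of_tendsto' (hlim x) (fun k => (critSeq_prop ha hL k).2.2 x)
  have h0 : ∀ k x, 0 ≤ g k x := fun k x => zero_le_one.trans ((critSeq_prop ha hL k).2.1 x)
  have hH : ∀ t, Tendsto (fun k => critHop a (g k) t) atTop (𝓝 (critHop a u t)) := by
    intro t
    refine intervalIntegral.tendsto_integral_filter_of_dominated_convergence
      (fun _ => critG L t) ?_ ?_ ?_ ?_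
    · refine Eventually.of_forall fun k => ?_
      have := (critHop_integrable ha (critSeq_prop ha hL k).1 t).aestronglyMeasurable
      rwa [Set.uIoc_of_le zero_le_one]
    · refine Eventually.of_forall fun k => Eventually.of_forall fun r hr => ?_
      rw [Set.uIoc_of_le zero_le_one] at hr
      rw [Real.norm_of_nonneg (mul_nonneg (Real.rpow_nonneg hr.1.le a)
        (div_nonneg (h0 _ _) (by positivity)))]
      exact critBound ha hL (h0 k) (critSeq_prop ha hL k).2.2 t ⟨hr.1.le, hr.2⟩
    · exact _root_.intervalIntegrable_const
    · refine Eventually.of_forall fun r hr => ?_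
      exact ((hlim (r * t)).div_const _).const_mul _
  have hHm : Measurable (critHop a u) :=
    measurable_of_tendsto_metrizable (fun k => (critHop_cont ha (critSeq_prop ha hL k).1).measurable)
      (tendsto_pi_nhds.2 hH)
  have hHG : ∀ t, critHop a u t ≤ critG L t := fun t =>
    le_of_tendsto' (hH t) (fun k => critHop_le ha hL (critSeq_prop ha hL k).1 (h0 k)
      (critSeq_prop ha hL k).2.2 t)
  have hH0 : ∀ t, 0 ≤ critHop a u t := critHop_nonneg (fun x => zero_le_one.trans (hu1 x))
  have hfix : ∀ x, u x = critTop a L u x := by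
    intro x
    have h1 : Tendsto (fun k => g (k+1) x) atTop (𝓝 (u x)) := (hlim x).comp (tendsto_add_atTop_nat 1)
    refine tendsto_nhds_unique h1 ?_
    change Tendsto (fun k => critTop a L (g k) x) atTop _
    unfold critTop
    refine Tendsto.const_add _ (Tendsto.const_mul _ ?_)
    refine intervalIntegral.tendsto_integral_filter_of_dominated_convergence
      (fun s => L * critG L x) ?_ ?_ ?_ ?_
    · refine Eventually.of_forall fun k => ?_
      have := critHop_cont ha (critSeq_prop ha hL k).1
      exact Continuous.aestronglyMeasurable (by fun_prop)
    · refine Eventually.of_forall fun k => Eventually.of_forall fun r hr => ?_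
      rw [Set.uIoc_of_le zero_le_one] at hr
      have e1 := critHop_nonneg (a := a) (h0 k) (r * x)
      have e2 := (critHop_le ha hL (critSeq_prop ha hL k).1 (h0 k)
        (critSeq_prop ha hL k).2.2 (r * x)).trans (critG_le hL ⟨hr.1.le, hr.2⟩ x)
      have e3 := hr.1.le
      rw [Real.norm_of_nonneg (by positivity)]
      calc L * r * critHop a (g k) (r * x) ≤ L * 1 * critG L x := by
            gcongr
            exact hr.2
        _ = _ := by ring
    · exact _root_.intervalIntegrable_const
    · refine Eventually.of_forall fun r hr => ?_
      exact (hH (r * x)).const_mul _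
  have hfix2 : ∀ x, u x = 1 + ∫ t in (0:ℝ)..x, L * t * critHop a u t := by
    intro x
    rw [hfix x, critTop]
    congr 1
    have := intervalIntegral.mul_integral_comp_mul_right (a := 0) (b := 1)
      (f := fun t => L * t * critHop a u t) x
    simp only [zero_mul, one_mul] at this
    rw [← this, ← intervalIntegral.integral_const_mul, ← intervalIntegral.integral_const_mul]
    congr 1; ext s; ring
  refine ⟨u, ?_, hu1, hfix2⟩
  have hint : ∀ b c, IntervalIntegrable (fun t => L * t * critHop a u t) MeasureTheory.volume b c := by
    intro b c
    have h1 : IntervalIntegrable (fun t => L * |t| * critG L t) MeasureTheory.volume b c := by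
      have := critG_cont L
      exact Continuous.intervalIntegrable (by fun_prop) _ _
    refine h1.mono_fun (Measurable.aestronglyMeasurable (by fun_prop)) ?_
    refine Eventually.of_forall fun t => ?_
    simp only [norm_mul, Real.norm_eq_abs, abs_abs]
    have e1 := hHG t
    have e2 := hH0 t
    rw [abs_of_nonneg e2, abs_of_nonneg (e2.trans e1)]
    gcongr
  have := (intervalIntegral.continuous_primitive hint 0).const_add 1
  convert this using 1
  ext x; exact hfix2 x

lemma crit_sol {a L : ℝ} (ha : 0 ≤ a) (hL : 0 < L) :
    ∃ u d : ℝ → ℝ, (∀ x, HasDerivAt u (d x) x) ∧ Continuous d ∧ d 0 = 0 ∧ (∀ x, 1 ≤ u x) ∧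
      (∀ x, 0 ≤ x → 0 ≤ d x) ∧
      ∀ x, 0 < x → HasDerivAt d (L * (u x / (1 + x ^ 2)) - a / x * d x) x := by
  obtain ⟨u, hu, hu1, hfix⟩ := crit_fixed ha hL
  have hc := critHop_cont ha hu
  have hc2 : Continuous (fun t => L * t * critHop a u t) := by fun_prop
  refine ⟨u, fun t => L * t * critHop a u t, ?_, hc2, by simp, hu1, ?_, ?_⟩
  · intro x
    have := (intervalIntegral.integral_hasDerivAt_right (hc2.intervalIntegrable 0 x)
      hc2.stronglyMeasurable.stronglyMeasurableAtFilter hc2.continuousAt).const_add 1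
    exact this.congr_of_eventuallyEq (Eventually.of_forall hfix)
  · intro x hx
    have := critHop_nonneg (a := a) (fun x => zero_le_one.trans (hu1 x)) x
    positivity
  · intro x hx
    let F : ℝ → ℝ := fun s => s ^ a * (u s / (1 + s ^ 2))
    have hF : Continuous F :=
      (Real.continuous_rpow_const ha).mul (hu.div (by fun_prop) (fun p => by positivity))
    have hI : HasDerivAt (fun x => ∫ s in (0:ℝ)..x, F s) (F x) x :=
      intervalIntegral.integral_hasDerivAt_right (hF.intervalIntegrable 0 x)
        hF.stronglyMeasurable.stronglyMeasurableAtFilter hF.continuousAt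
    have heq : ∀ t, 0 < t → L * t * critHop a u t = L * (t ^ (-a) * ∫ s in (0:ℝ)..t, F s) := by
      intro t ht
      have := intervalIntegral.mul_integral_comp_mul_right (a := 0) (b := 1) (f := F) t
      simp only [zero_mul, one_mul] at this
      rw [← this, mul_assoc, critHop]
      congr 1
      rw [mul_left_comm]
      congr 1
      rw [← intervalIntegral.integral_const_mul]
      refine intervalIntegral.integral_congr fun r hr => ?_
      rw [Set.uIcc_of_le zero_le_one] at hr
      simp only [F]
      rw [Real.mul_rpow hr.1 ht.le, Real.rpow_neg ht.le]
      have := (Real.rpow_pos_of_pos ht a).ne'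
      field_simp
    have hd : HasDerivAt (fun t : ℝ => L * (t ^ (-a) * ∫ s in (0:ℝ)..t, F s))
        (L * ((-a * x ^ (-a - 1)) * (∫ s in (0:ℝ)..x, F s) + x ^ (-a) * F x)) x :=
      ((Real.hasDerivAt_rpow_const (p := -a) (Or.inl hx.ne')).mul hI).const_mul L
    have hd2 := hd.congr_of_eventuallyEq (f₁ := fun t => L * t * critHop a u t)
      (by filter_upwards [Ioi_mem_nhds hx] with t ht using heq t ht)
    refine hd2.congr_deriv ?_
    beta_reduce
    rw [heq x hx]
    simp only [F]
    rw [Real.rpow_sub hx, Real.rpow_one, Real.rpow_neg hx.le]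
    have := (Real.rpow_pos_of_pos hx a).ne'
    field_simp
    ring

lemma crit_mono_Ici {f f' : ℝ → ℝ} (hc : ContinuousOn f (Set.Ici 0))
    (hd : ∀ x, 0 < x → HasDerivAt f (f' x) x) (h : ∀ x, 0 < x → 0 ≤ f' x) (x : ℝ) (hx : 0 ≤ x) :
    f 0 ≤ f x := by
  have : MonotoneOn f (Set.Ici 0) := by
    refine monotoneOn_of_deriv_nonneg (convex_Ici 0) hc ?_ ?_
    · rw [interior_Ici]
      exact fun y hy => (hd y hy).differentiableAt.differentiableWithinAt
    · rw [interior_Ici]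
      intro y hy
      rw [(hd y hy).deriv]; exact h y hy
  exact this Set.self_mem_Ici hx hx

lemma crit_mono_Ioi {f f' : ℝ → ℝ}
    (hd : ∀ x, 0 < x → HasDerivAt f (f' x) x) (h : ∀ x, 0 < x → 0 ≤ f' x) :
    MonotoneOn f (Set.Ioi 0) := by
  refine monotoneOn_of_deriv_nonneg (convex_Ioi 0)
    (fun y hy => (hd y hy).continuousAt.continuousWithinAt) ?_ ?_
  · rw [interior_Ioi]
    exact fun y hy => (hd y hy).differentiableAt.differentiableWithinAt
  · rw [interior_Ioi]
    intro y hy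
    rw [(hd y hy).deriv]; exact h y hy

lemma crit_asymp {a L ν : ℝ} (hL : 0 < L) 
    (hp : 0 < a - 1 + ν) (hrel : ν * (a - 1 + ν) = L) {u d : ℝ → ℝ}
    (hu : ∀ x, HasDerivAt u (d x) x) (hdc : Continuous d) (hu1 : ∀ x, 1 ≤ u x)
    (hd0 : ∀ x, 0 ≤ x → 0 ≤ d x)
    (hd : ∀ x, 0 < x → HasDerivAt d (L * (u x / (1 + x ^ 2)) - a / x * d x) x) :
    ∃ c, 0 < c ∧ Tendsto (fun x => u x / x ^ ν) atTop (𝓝 c) := by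
  obtain ⟨p, hpdef⟩ : ∃ p, p = a - 1 + ν := ⟨_, rfl⟩
  rw [← hpdef] at hp hrel
  have hap : a = p + 1 - ν := by linarith
  subst hap
  have huc : Continuous u := continuous_iff_continuousAt.2 fun x => (hu x).continuousAt
  set W : ℝ → ℝ := fun x => x ^ p * (x * d x - ν * u x) with hW
  have hWc : Continuous W := by
    have := Real.continuous_rpow_const hp.le
    fun_prop
  have hW0 : W 0 = 0 := by simp [hW, Real.zero_rpow hp.ne']
  have hWd : ∀ x, 0 < x → HasDerivAt W (-(L * x ^ p / x * (u x / (1 + x ^ 2)))) x := by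
    intro x hx
    have h1 := (Real.hasDerivAt_rpow_const (p := p) (Or.inl hx.ne')).mul
      (((hasDerivAt_id x).mul (hd x hx)).sub ((hu x).const_mul ν))
    refine h1.congr_deriv ?_
    simp only [id, Pi.mul_apply, Pi.sub_apply]
    rw [Real.rpow_sub hx, Real.rpow_one, ← hrel]
    field_simp
    ring
  have hupos : ∀ x, 0 < u x := fun x => zero_lt_one.trans_le (hu1 x)
  have hWneg : ∀ x, 0 ≤ x → W x ≤ 0 := by
    intro x hx
    have := crit_mono_Ici (f := fun x => - W x) hWc.neg.continuousOn
      (fun x hx => (hWd x hx).neg) (fun x hx => by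
        have := Real.rpow_pos_of_pos hx p
        have := hupos x
        rw [neg_neg]; positivity) x hx
    simp only [hW0] at this
    linarith
  set θ := min (p / 2) 1 with hθ
  have hθ0 : 0 < θ := by positivity
  have hθp : 0 < p - θ := by have := min_le_left (p / 2) 1; linarith
  have hθ1 : θ ≤ 1 := min_le_right _ _
  set K := L / (p - θ) with hK
  have hKp : 0 < K := by positivity
  have hVnn : ∀ x, 0 ≤ x → 0 ≤ W x + K * (x ^ (p - θ) * u x) := by
    intro x hx
    have := crit_mono_Ici (f := fun x => W x + K * (x ^ (p - θ) * u x))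
      (f' := fun x => -(L * x ^ p / x * (u x / (1 + x ^ 2))) +
        K * (((p - θ) * x ^ (p - θ - 1)) * u x + x ^ (p - θ) * d x)) (by
        have := Real.continuous_rpow_const hθp.le
        exact Continuous.continuousOn (by fun_prop))
      (fun x hx => (hWd x hx).add
        (((Real.hasDerivAt_rpow_const (p := p - θ) (Or.inl hx.ne')).mul (hu x)).const_mul K))
      (fun x hx => by
        have e1 := Real.rpow_pos_of_pos hx p
        have e2 := hupos x
        have e3 := Real.rpow_pos_of_pos hx (p - θ)
        have e4 := hd0 x hx.le
        have e5 := Real.rpow_pos_of_pos hx θ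
        have e6 : x ^ θ ≤ 1 + x ^ 2 := by
          rcases le_total x 1 with h | h
          · have := Real.rpow_le_one hx.le h hθ0.le
            nlinarith [sq_nonneg x]
          · have := Real.rpow_le_rpow_of_exponent_le h hθ1
            rw [Real.rpow_one] at this
            nlinarith
        have e7 : u x / (1 + x ^ 2) ≤ u x / x ^ θ := by gcongr
        have e8 : 0 ≤ K * (x ^ (p - θ) * d x) := by positivity
        have e9 : K * ((p - θ) * x ^ (p - θ - 1) * u x) = L * x ^ p / x * (u x / x ^ θ) := by
          rw [hK, Real.rpow_sub hx, Real.rpow_sub hx, Real.rpow_one]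
          field_simp
        have e10 : L * x ^ p / x * (u x / (1 + x ^ 2)) ≤ L * x ^ p / x * (u x / x ^ θ) := by
          gcongr
        simp only [mul_add]
        linarith) x hx
    simpa [hW0, Real.zero_rpow hθp.ne'] using this
  have hanti : MonotoneOn (fun x => -(u x * x ^ (-ν))) (Set.Ioi 0) := by
    refine crit_mono_Ioi (f' := fun x => - (d x * x ^ (-ν) + u x * (-ν * x ^ (-ν - 1))))
      (fun x hx => ((hu x).mul (Real.hasDerivAt_rpow_const (Or.inl hx.ne'))).neg) ?_
    intro x hx
    have e1 := hWneg x hx.le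
    have e2 := Real.rpow_pos_of_pos hx p
    have e3 : x * d x - ν * u x ≤ 0 := by
      by_contra! hcon
      have := mul_pos e2 hcon
      simp only [hW] at e1
      linarith
    have e4 := Real.rpow_pos_of_pos hx (-ν)
    rw [Real.rpow_sub hx, Real.rpow_one]
    have : -(d x * x ^ (-ν) + u x * (-ν * (x ^ (-ν) / x))) = x ^ (-ν) / x * -(x * d x - ν * u x) := by
      field_simp
      ring
    rw [this]
    have : 0 ≤ -(x * d x - ν * u x) := by linarith
    positivity
  have hlog : MonotoneOn (fun x => Real.log (u x) - ν * Real.log x - K / θ * x ^ (-θ)) (Set.Ioi 0) := by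
    refine crit_mono_Ioi (f' := fun x => d x / u x - ν * x⁻¹ - K / θ * (-θ * x ^ (-θ - 1)))
      (fun x hx => (((hu x).log (hupos x).ne').sub ((Real.hasDerivAt_log hx.ne').const_mul ν)).sub
        ((Real.hasDerivAt_rpow_const (Or.inl hx.ne')).const_mul _)) ?_
    intro x hx
    have e1 := hVnn x hx.le
    have e2 := Real.rpow_pos_of_pos hx p
    have e3 := Real.rpow_pos_of_pos hx θ
    have e4 := hupos x
    have : d x / u x - ν * x⁻¹ - K / θ * (-θ * x ^ (-θ - 1)) =
        (W x + K * (x ^ (p - θ) * u x)) / (x ^ p * x * u x) := by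
      simp only [hW]
      rw [Real.rpow_sub hx, Real.rpow_sub hx, Real.rpow_one, Real.rpow_neg hx.le]
      field_simp
      ring
    rw [this]
    positivity
  set m := Real.log (u 1) - K / θ with hm
  have hlow : ∀ x, 1 ≤ x → Real.exp m ≤ u x * x ^ (-ν) := by
    intro x hx
    have hx0 : 0 < x := by linarith
    have h1 := hlog (show (1:ℝ) ∈ Set.Ioi 0 by simp) (show x ∈ Set.Ioi 0 from hx0) hx
    simp only [Real.log_one, Real.one_rpow] at h1
    have h2 : 0 ≤ K / θ * x ^ (-θ) := by positivity
    have h3 : m ≤ Real.log (u x) + Real.log x * (-ν) := by rw [hm]; linarith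
    calc Real.exp m ≤ Real.exp (Real.log (u x) + Real.log x * (-ν)) := Real.exp_le_exp.2 h3
      _ = _ := by rw [Real.exp_add, Real.exp_log (hupos x), Real.rpow_def_of_pos hx0]
  let f : ℝ → ℝ := fun x => u (max x 1) * (max x 1) ^ (-ν)
  have hf : Antitone f := by
    intro x y hxy
    have h1 := hanti (show max x 1 ∈ Set.Ioi (0:ℝ) by simp) (show max y 1 ∈ Set.Ioi (0:ℝ) by simp)
      (max_le_max_right 1 hxy)
    simp only [neg_le_neg_iff] at h1
    exact h1
  have hfl : ∀ x, Real.exp m ≤ f x := fun x => hlow _ (le_max_right _ _)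
  have ht := tendsto_atTop_ciInf hf ⟨Real.exp m, by rintro _ ⟨x, rfl⟩; exact hfl x⟩
  refine ⟨_, lt_of_lt_of_le (Real.exp_pos m) (le_ciInf hfl), ht.congr' ?_⟩
  filter_upwards [eventually_ge_atTop 1] with x hx
  simp only [f, max_eq_left hx]
  rw [Real.rpow_neg (by linarith), div_eq_mul_inv]

lemma crit_const_Ici {f : ℝ → ℝ} (hc : ContinuousOn f (Set.Ici 0))
    (hd : ∀ x, 0 < x → HasDerivAt f 0 x) (x : ℝ) (hx : 0 ≤ x) : f x = f 0 := by
  have h1 := crit_mono_Ici (f' := fun _ => 0) hc hd (fun _ _ => le_rfl) x hx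
  have h2 := crit_mono_Ici (f := fun x => - f x) (f' := fun _ => -0) hc.neg
    (fun x hx => (hd x hx).neg) (fun _ _ => by simp) x hx
  linarith

lemma crit_unique {a L : ℝ} (ha : 0 ≤ a) {u d ψ D : ℝ → ℝ}
    (hu : ∀ x, HasDerivAt u (d x) x) (hdc : Continuous d) (hd0 : d 0 = 0) (hu1 : ∀ x, 1 ≤ u x)
    (hd : ∀ x, 0 < x → HasDerivAt d (L * (u x / (1 + x ^ 2)) - a / x * d x) x)
    (hψc : ContinuousOn ψ (Set.Ici 0)) (hDc : ContinuousOn D (Set.Ici 0)) (hD0 : D 0 = 0)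
    (hψ : ∀ x, 0 < x → HasDerivAt ψ (D x) x)
    (hD : ∀ x, 0 < x → HasDerivAt D (L * (ψ x / (1 + x ^ 2)) - a / x * D x) x) :
    ∃ k, ∀ x, 0 ≤ x → ψ x = k * u x := by
  have huc : Continuous u := continuous_iff_continuousAt.2 fun x => (hu x).continuousAt
  have hupos : ∀ x, 0 < u x := fun x => zero_lt_one.trans_le (hu1 x)
  have hW : ∀ x, 0 < x → D x * u x - ψ x * d x = 0 := by
    intro x hx
    have h := crit_const_Ici (f := fun x => x ^ a * (D x * u x - ψ x * d x))
      ((Real.continuous_rpow_const ha).continuousOn.mul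
        ((hDc.mul huc.continuousOn).sub (hψc.mul hdc.continuousOn))) (fun x hx => by
        have h1 := (Real.hasDerivAt_rpow_const (p := a) (Or.inl hx.ne')).mul
          (((hD x hx).mul (hu x)).sub ((hψ x hx).mul (hd x hx)))
        refine h1.congr_deriv ?_
        simp only [Pi.mul_apply, Pi.sub_apply]
        rw [Real.rpow_sub hx, Real.rpow_one]
        field_simp
        ring) x hx.le
    simp only [hD0, hd0, zero_mul, mul_zero, sub_zero] at h
    exact (mul_eq_zero.1 h).resolve_left (Real.rpow_pos_of_pos hx a).ne'
  refine ⟨ψ 0 / u 0, fun x hx => ?_⟩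
  have h := crit_const_Ici (f := fun x => ψ x / u x)
    (hψc.div huc.continuousOn (fun x _ => (hupos x).ne')) (fun x hx => by
      refine ((hψ x hx).div (hu x) (hupos x).ne').congr_deriv ?_
      rw [hW x hx, zero_div]) x hx
  have := hupos x
  rw [← h]
  field_simp

/-- For `μ ≥ -1/2`, `λ > 0` and `n_μ = (-μ+√(μ²+λ))/2` there is a unique function on
`[0,∞)` solving the Bessel-type Sturm–Liouville equation with `φ'(0) = 0` and
`φ(x) ~ x^{2n_μ}` at infinity; moreover this solution is strictly positive. -/
theorem critical_SL_solution_exists_unique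
    (μ lam : ℝ) (hμ : -(1/2) ≤ μ) (hlam : 0 < lam)
    (n : ℝ) (hn : n = (-μ + Real.sqrt (μ ^ 2 + lam)) / 2) :
    ∃ φ : ℝ → ℝ, IsCriticalSLSolution μ lam n φ ∧
      (∀ ψ : ℝ → ℝ, IsCriticalSLSolution μ lam n ψ → Set.EqOn ψ φ (Set.Ici 0)) ∧
      (∀ x : ℝ, 0 ≤ x → 0 < φ x) := by
  obtain ⟨a, ha⟩ : ∃ a, a = 2 * μ + 1 := ⟨_, rfl⟩
  obtain ⟨ν, hν⟩ : ∃ ν, ν = 2 * n := ⟨_, rfl⟩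
  have ha0 : 0 ≤ a := by linarith
  have hs := Real.sq_sqrt (show 0 ≤ μ ^ 2 + lam by positivity)
  have hs0 := Real.sqrt_nonneg (μ ^ 2 + lam)
  set S := Real.sqrt (μ ^ 2 + lam) with hS
  have hνS : ν = -μ + S := by rw [hν, hn]; ring
  have hSμ : 0 < μ + S := by
    by_contra! hcon
    nlinarith
  have hp : 0 < a - 1 + ν := by rw [ha, hνS]; linarith
  have hrel : ν * (a - 1 + ν) = lam := by rw [ha, hνS]; linear_combination hs
  obtain ⟨u, d, hu, hdc, hd0, hu1, hdnn, hd⟩ := crit_sol ha0 hlam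
  obtain ⟨c, hc, hlim⟩ := crit_asymp hlam hp hrel hu hdc hu1 hdnn hd
  have hupos : ∀ x, 0 < u x := fun x => zero_lt_one.trans_le (hu1 x)
  have huc : Continuous u := continuous_iff_continuousAt.2 fun x => (hu x).continuousAt
  have hφd : ∀ x, HasDerivAt (fun x => u x / c) (d x / c) x := fun x => (hu x).div_const c
  have hder : deriv (fun x => u x / c) = fun x => d x / c := funext fun x => (hφd x).deriv
  have hdW : ∀ x ∈ Set.Ici (0:ℝ), derivWithin (fun x => u x / c) (Set.Ici 0) x = d x / c :=
    fun x hx => (hφd x).hasDerivWithinAt.derivWithin (uniqueDiffOn_Ici 0 x hx)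
  have hd2 : ∀ x, 0 < x → HasDerivAt (fun x => d x / c)
      ((lam * (u x / (1 + x ^ 2)) - a / x * d x) / c) x := fun x hx => (hd x hx).div_const c
  refine ⟨fun x => u x / c, ⟨?_, ?_, ?_, ?_, ?_⟩, ?_, fun x _ => div_pos (hupos x) hc⟩
  · refine ContDiff.contDiffOn ?_
    rw [contDiff_one_iff_deriv, hder]
    exact ⟨fun x => (hφd x).differentiableAt, hdc.div_const c⟩
  · rw [hdW 0 Set.self_mem_Ici, hd0, zero_div]
  · rw [show (2 : WithTop ℕ∞) = 1 + 1 by norm_num, contDiffOn_succ_iff_deriv_of_isOpen isOpen_Ioi]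
    refine ⟨fun x _ => (hφd x).differentiableAt.differentiableWithinAt, by simp, ?_⟩
    rw [hder, show (1 : WithTop ℕ∞) = 0 + 1 by norm_num,
      contDiffOn_succ_iff_deriv_of_isOpen isOpen_Ioi]
    refine ⟨fun x hx => (hd2 x hx).differentiableAt.differentiableWithinAt, by simp, ?_⟩
    rw [contDiffOn_zero]
    refine ContinuousOn.congr (f := fun x => (lam * (u x / (1 + x ^ 2)) - a / x * d x) / c) ?_
      (fun x hx => (hd2 x hx).deriv)
    refine ContinuousOn.div_const (ContinuousOn.sub ?_ ?_) _
    · exact Continuous.continuousOn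
        (continuous_const.mul (huc.div (by fun_prop) (fun x => by positivity)))
    · exact (continuousOn_const.div continuousOn_id (fun x hx => ne_of_gt hx)).mul hdc.continuousOn
  · intro x hx
    have h2 : derivWithin (derivWithin (fun x => u x / c) (Set.Ici 0)) (Set.Ici 0) x =
        (lam * (u x / (1 + x ^ 2)) - a / x * d x) / c := by
      rw [derivWithin_congr hdW (hdW x hx.le)]
      exact (hd2 x hx).hasDerivWithinAt.derivWithin (uniqueDiffOn_Ici 0 x hx.le)
    rw [h2, hdW x hx.le, ha]
    field_simp
    ring
  · rw [← hν]
    have := hlim.div_const c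
    rw [div_self hc.ne'] at this
    refine this.congr fun x => ?_
    rw [div_right_comm]
  · rintro ψ ⟨h1, h2, h3, h4, h5⟩
    set D := derivWithin ψ (Set.Ici 0) with hDdef
    have hψ : ∀ x, 0 < x → HasDerivAt ψ (D x) x := fun x hx =>
      ((h1.differentiableOn (by simp)) x hx.le).hasDerivWithinAt.hasDerivAt (Ici_mem_nhds hx)
    have hDc : ContinuousOn D (Set.Ici 0) :=
      h1.continuousOn_derivWithin (uniqueDiffOn_Ici 0) (by simp)
    have hD : ∀ x, 0 < x → HasDerivAt D (lam * (ψ x / (1 + x ^ 2)) - a / x * D x) x := by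
      intro x hx
      rw [show (2 : WithTop ℕ∞) = 1 + 1 by norm_num,
        contDiffOn_succ_iff_deriv_of_isOpen isOpen_Ioi] at h3
      have e1 : DifferentiableAt ℝ (deriv ψ) x :=
        (h3.2.2.differentiableOn (by simp)).differentiableAt (Ioi_mem_nhds hx)
      have e2 : D =ᶠ[𝓝 x] deriv ψ := by
        filter_upwards [Ioi_mem_nhds hx] with y hy using (hψ y hy).deriv.symm
      have e3 : DifferentiableAt ℝ D x := e1.congr_of_eventuallyEq e2
      have e4 := e3.differentiableWithinAt.hasDerivWithinAt.hasDerivAt (Ici_mem_nhds hx)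
      refine e4.congr_deriv ?_
      have e5 := h4 x hx
      rw [ha]
      have e6 : (2 * μ + 1) / (2 * x) = (2 * μ + 1) / x / 2 := by field_simp
      rw [e6] at e5
      linarith
    obtain ⟨k, hk⟩ := crit_unique ha0 hu hdc hd0 hu1 hd h1.continuousOn hDc h2 hψ hD
    have hkc : k * c = 1 := by
      refine tendsto_nhds_unique ((hlim.const_mul k).congr' ?_) h5
      filter_upwards [eventually_ge_atTop 0] with x hx
      rw [hk x hx, ← hν, mul_div_assoc]
    intro x hx
    simp only
    rw [hk x hx, eq_div_iff hc.ne']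
    linear_combination u x * hkc
end

section
/- Let V : ℝ → ℝ be continuous, even, nondecreasing on [0,∞), with V(x) → V̄ ∈ ℝ as x → +∞ and V(0) < V̄. Then there exists a unique γ_0 ∈ (V(0), V̄) with the following property: there exists an even C² function φ : ℝ → (0,∞) satisfying φ''(x) = (V(x) − γ_0)·φ(x) for all x ∈ ℝ and lim_{x→+∞} φ(x) = 0. -/
open Filter Topology

/-- even Picard iterates -/
noncomputable def pit (W : ℝ → ℝ → ℝ) : ℕ → ℝ → ℝ → ℝ
  | 0 => fun _ _ => 1
  | n + 1 => fun a x => ∫ t in (0:ℝ)..x, ∫ s in (0:ℝ)..t, W a s * pit W n a s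

/-- odd Picard iterates -/
noncomputable def qit (W : ℝ → ℝ → ℝ) (n : ℕ) (a x : ℝ) : ℝ :=
  ∫ s in (0:ℝ)..x, W a s * pit W n a s

lemma pit_zero (W : ℝ → ℝ → ℝ) (a x : ℝ) : pit W 0 a x = 1 := rfl

lemma pit_succ (W : ℝ → ℝ → ℝ) (n : ℕ) (a x : ℝ) :
    pit W (n + 1) a x = ∫ t in (0:ℝ)..x, qit W n a t := rfl

lemma pq_cont {W : ℝ → ℝ → ℝ} (hW : Continuous W.uncurry) (n : ℕ) :
    Continuous (pit W n).uncurry ∧ Continuous (qit W n).uncurry := by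
  have key : ∀ f : ℝ → ℝ → ℝ, Continuous f.uncurry →
      Continuous (fun z : ℝ × ℝ => ∫ t in (0:ℝ)..z.2, f z.1 t) := by
    intro f hf
    refine intervalIntegral.continuous_parametric_intervalIntegral_of_continuous
      (f := fun z : ℝ × ℝ => f z.1) ?_ continuous_snd
    exact hf.comp ((continuous_fst.comp continuous_fst).prodMk continuous_snd)
  have step : ∀ n, Continuous (pit W n).uncurry → Continuous (qit W n).uncurry :=
    fun n h => key (fun a s => W a s * pit W n a s) (hW.mul h)
  have hp : Continuous (pit W n).uncurry := by
    induction n with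
    | zero => exact continuous_const
    | succ n ih => exact key _ (step n ih)
  exact ⟨hp, step n hp⟩

lemma pq_even {W : ℝ → ℝ → ℝ} (hE : ∀ a x, W a (-x) = W a x) (n : ℕ) (a : ℝ) :
    (∀ x, pit W n a (-x) = pit W n a x) ∧ (∀ x, qit W n a (-x) = - qit W n a x) := by
  have step : ∀ n, (∀ x, pit W n a (-x) = pit W n a x) →
      (∀ x, qit W n a (-x) = - qit W n a x) := by
    intro n h x
    have := intervalIntegral.integral_comp_neg (a := 0) (b := x)
      (fun s => W a s * pit W n a s)
    simp only [hE, h, neg_zero] at this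
    unfold qit
    rw [this, intervalIntegral.integral_symm]
  have hp : ∀ x, pit W n a (-x) = pit W n a x := by
    induction n with
    | zero => intro x; rfl
    | succ n ih =>
      intro x
      have := intervalIntegral.integral_comp_neg (a := 0) (b := x) (fun s => qit W n a s)
      simp only [step n ih, neg_zero, intervalIntegral.integral_neg] at this
      rw [pit_succ, pit_succ, intervalIntegral.integral_symm, ← this, neg_neg]
  exact ⟨hp, step n hp⟩

lemma pq_bound_nonneg {W : ℝ → ℝ → ℝ} {a R M : ℝ} (hM : 0 ≤ M) (hR : 0 ≤ R)
    (hWb : ∀ x, |x| ≤ R → |W a x| ≤ M) (n : ℕ) :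
    (∀ x, 0 ≤ x → x ≤ R → |pit W n a x| ≤ (M * R) ^ n * x ^ n / n.factorial) ∧
    (∀ x, 0 ≤ x → x ≤ R →
      |qit W n a x| ≤ M * (M * R) ^ n * x ^ (n + 1) / (n + 1).factorial) := by
  have step : ∀ n : ℕ, (∀ x, 0 ≤ x → x ≤ R → |pit W n a x| ≤ (M * R) ^ n * x ^ n / n.factorial) →
    (∀ x, 0 ≤ x → x ≤ R →
      |qit W n a x| ≤ M * (M * R) ^ n * x ^ (n + 1) / (n + 1).factorial) := by
    intro n h x hx hxR
    have h1 : ‖qit W n a x‖ ≤ ∫ s in (0:ℝ)..x, M * ((M * R) ^ n / n.factorial) * s ^ n := by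
      refine intervalIntegral.norm_integral_le_of_norm_le hx (Eventually.of_forall ?_)
        (Continuous.intervalIntegrable (by fun_prop) _ _)
      intro s hs
      rw [Real.norm_eq_abs, abs_mul]
      have h2 := h s hs.1.le (hs.2.trans hxR)
      have h3 := hWb s (by rw [abs_of_pos hs.1]; exact hs.2.trans hxR)
      calc _ ≤ M * ((M * R) ^ n * s ^ n / n.factorial) :=
            mul_le_mul h3 h2 (abs_nonneg _) hM
        _ = _ := by ring
    rw [intervalIntegral.integral_const_mul, integral_pow] at h1
    refine h1.trans (le_of_eq ?_)
    rw [Nat.factorial_succ]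
    push_cast
    have : (n.factorial : ℝ) ≠ 0 := by positivity
    have : (n + 1 : ℝ) ≠ 0 := by positivity
    field_simp
    simp
  have hp : (∀ x, 0 ≤ x → x ≤ R → |pit W n a x| ≤ (M * R) ^ n * x ^ n / n.factorial) := by
    induction n with
    | zero => intro x _ _; simp [pit_zero]
    | succ n ih =>
      intro x hx hxR
      have h1 : ‖pit W (n+1) a x‖ ≤ (M * (M * R) ^ n * x ^ (n + 1) / (n + 1).factorial) * |x - 0| := by
        rw [pit_succ]
        refine intervalIntegral.norm_integral_le_of_norm_le_const ?_
        intro s hs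
        rw [Set.uIoc_of_le hx] at hs
        refine (step n ih s hs.1.le (hs.2.trans hxR)).trans ?_
        have := hs.1.le
        have := hs.2
        gcongr
      refine h1.trans ?_
      rw [sub_zero, abs_of_nonneg hx]
      calc _ ≤ (M * (M * R) ^ n * x ^ (n + 1) / (n + 1).factorial) * R := by gcongr
        _ = _ := by ring
  exact ⟨hp, step n hp⟩

lemma pq_bound {W : ℝ → ℝ → ℝ} (hE : ∀ a x, W a (-x) = W a x) {a R M : ℝ} (hM : 0 ≤ M) (hR : 0 ≤ R)
    (hWb : ∀ x, |x| ≤ R → |W a x| ≤ M) (n : ℕ) (x : ℝ) (hx : |x| ≤ R) :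
    |pit W n a x| ≤ (M * R * R) ^ n / n.factorial ∧
    |qit W n a x| ≤ M * R * ((M * R * R) ^ n / n.factorial) := by
  obtain ⟨b1, b2⟩ := pq_bound_nonneg hM hR hWb n
  obtain ⟨e1, e2⟩ := pq_even hE n a
  have c1 : |pit W n a x| = |pit W n a (|x|)| := by
    rcases abs_choice x with h | h <;> rw [h]
    rw [e1]
  have c2 : |qit W n a x| = |qit W n a (|x|)| := by
    rcases abs_choice x with h | h <;> rw [h]
    rw [e2, abs_neg]
  rw [c1, c2]
  have hx0 := abs_nonneg x
  constructor
  · refine (b1 _ hx0 hx).trans ?_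
    calc _ ≤ (M * R) ^ n * R ^ n / n.factorial := by gcongr
      _ = _ := by rw [mul_pow (M * R) R]
  · refine (b2 _ hx0 hx).trans ?_
    calc _ ≤ M * (M * R) ^ n * R ^ (n + 1) / n.factorial := by
          gcongr
          exact Nat.le_succ n
      _ = _ := by rw [mul_pow (M * R) R]; ring

lemma exists_flow {W : ℝ → ℝ → ℝ} (hW : Continuous W.uncurry) (hE : ∀ a x, W a (-x) = W a x) :
    ∃ F G : ℝ → ℝ → ℝ, Continuous F.uncurry ∧ Continuous G.uncurry ∧
      (∀ a x, HasDerivAt (F a) (G a x) x) ∧ (∀ a x, HasDerivAt (G a) (W a x * F a x) x) ∧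
      (∀ a, F a 0 = 1) ∧ (∀ a, G a 0 = 0) ∧ (∀ a x, F a (-x) = F a x) := by
  have hb : ∀ R : ℝ, ∃ M, 0 ≤ M ∧ ∀ a x, |a| ≤ R → |x| ≤ R → |W a x| ≤ M := by
    intro R
    obtain ⟨M, hM⟩ := ((isCompact_Icc (a := -R) (b := R)).prod
      (isCompact_Icc (a := -R) (b := R))).exists_bound_of_continuousOn hW.continuousOn
    refine ⟨max M 0, le_max_right _ _, fun a x ha hx => le_max_of_le_left ?_⟩
    exact hM (a, x) ⟨abs_le.1 ha, abs_le.1 hx⟩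
  have hsum : ∀ K : ℝ, Summable (fun n : ℕ => K ^ n / n.factorial) := Real.summable_pow_div_factorial
  -- bounds
  have hB : ∀ R : ℝ, 0 ≤ R → ∃ K C : ℝ, ∀ a x, |a| ≤ R → |x| ≤ R → ∀ n,
      |pit W n a x| ≤ K ^ n / n.factorial ∧ |qit W n a x| ≤ C * (K ^ n / n.factorial) ∧
      |W a x * pit W n a x| ≤ C * (K ^ n / n.factorial) := by
    intro R hR
    obtain ⟨M, hM, h⟩ := hb R
    refine ⟨M * R * R, M * R + M, fun a x ha hx n => ?_⟩
    obtain ⟨h1, h2⟩ := pq_bound hE hM hR (fun x hx => h a x ha hx) n x hx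
    have h0 : 0 ≤ (M * R * R) ^ n / n.factorial := by positivity
    refine ⟨h1, h2.trans ?_, ?_⟩
    · gcongr; linarith
    · rw [abs_mul]
      calc _ ≤ M * ((M * R * R) ^ n / n.factorial) := mul_le_mul (h a x ha hx) h1 (abs_nonneg _) hM
        _ ≤ _ := by gcongr; nlinarith
  have hglob : ∀ f : ℕ → ℝ → ℝ → ℝ, (∀ n, Continuous (f n).uncurry) →
      (∀ R : ℝ, 0 ≤ R → ∃ u : ℕ → ℝ, Summable u ∧ ∀ n a x, |a| ≤ R → |x| ≤ R → |f n a x| ≤ u n) →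
      Continuous (fun z : ℝ × ℝ => ∑' n, f n z.1 z.2) := by
    intro f hf hu
    rw [continuous_iff_continuousAt]
    intro z
    obtain ⟨u, hus, hu⟩ := hu (‖z‖ + 1) (by positivity)
    have : ContinuousOn (fun z : ℝ × ℝ => ∑' n, f n z.1 z.2) (Metric.ball z 1) := by
      refine continuousOn_tsum (fun n => (hf n).continuousOn) hus ?_
      intro n y hy
      have h1 : ‖y‖ ≤ ‖z‖ + 1 := by
        have := norm_le_norm_add_norm_sub' y z
        rw [mem_ball_iff_norm] at hy
        linarith
      exact hu n y.1 y.2 ((norm_fst_le y).trans h1) ((norm_snd_le y).trans h1)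
    exact this.continuousAt (Metric.ball_mem_nhds z one_pos)
  have hps : ∀ a x, Summable (fun n => pit W n a x) := by
    intro a x
    obtain ⟨K, C, h⟩ := hB (max |a| |x|) (le_max_of_le_left (abs_nonneg _))
    exact Summable.of_norm_bounded (hsum K)
      (fun n => (h a x (le_max_left _ _) (le_max_right _ _) n).1)
  have hF1 : ∀ a x, ∑' n, pit W n a x = 1 + ∑' n, pit W (n + 1) a x := by
    intro a x
    rw [(hps a x).tsum_eq_zero_add, pit_zero]
  have hcp := fun n => (pq_cont hW n).1
  have hcq := fun n => (pq_cont hW n).2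
  have hq0 : ∀ n a, qit W n a 0 = 0 := fun n a => by simp [qit]
  have hp0 : ∀ n a, pit W (n + 1) a 0 = 0 := fun n a => by simp [pit_succ]
  have sec : ∀ (f : ℝ → ℝ → ℝ) a, Continuous f.uncurry → Continuous (f a) := fun f a hf =>
    hf.comp (continuous_const.prodMk continuous_id)
  refine ⟨fun a x => ∑' n, pit W n a x, fun a x => ∑' n, qit W n a x, ?_, ?_, ?_, ?_, ?_, ?_, ?_⟩
  · refine hglob _ hcp fun R hR => ?_
    obtain ⟨K, C, h⟩ := hB R hR
    exact ⟨_, hsum K, fun n a x ha hx => (h a x ha hx n).1⟩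
  · refine hglob _ hcq fun R hR => ?_
    obtain ⟨K, C, h⟩ := hB R hR
    exact ⟨_, (hsum K).mul_left C, fun n a x ha hx => (h a x ha hx n).2.1⟩
  · intro a x
    set R := max |a| (|x| + 1) with hR
    have hR0 : 0 ≤ R := le_max_of_le_left (abs_nonneg _)
    have hxR : |x| + 1 ≤ R := le_max_right _ _
    obtain ⟨K, C, h⟩ := hB R hR0
    simp_rw [hF1]
    refine HasDerivAt.const_add 1 ?_
    have hx0 := abs_nonneg x
    refine hasDerivAt_tsum_of_isPreconnected (t := Metric.ball 0 R) (y₀ := 0)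
      ((hsum K).mul_left C) Metric.isOpen_ball
      (convex_ball 0 R).isPreconnected ?_ ?_ ?_ ?_ ?_
    · intro n y _
      exact intervalIntegral.integral_hasDerivAt_right
        ((sec _ a (hcq n)).intervalIntegrable _ _)
        ((sec _ a (hcq n)).stronglyMeasurableAtFilter _ _) (sec _ a (hcq n)).continuousAt
    · intro n y hy
      rw [mem_ball_zero_iff] at hy
      exact (h a y (le_max_left _ _) hy.le n).2.1
    · rw [mem_ball_zero_iff, norm_zero]; linarith
    · simp [hp0, summable_zero]
    · rw [mem_ball_zero_iff, Real.norm_eq_abs]; linarith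
  · intro a x
    set R := max |a| (|x| + 1) with hR
    have hR0 : 0 ≤ R := le_max_of_le_left (abs_nonneg _)
    have hxR : |x| + 1 ≤ R := le_max_right _ _
    obtain ⟨K, C, h⟩ := hB R hR0
    have hx0 := abs_nonneg x
    simp only
    rw [← tsum_mul_left]
    refine hasDerivAt_tsum_of_isPreconnected (t := Metric.ball 0 R) (y₀ := 0)
      (g' := fun n y => W a y * pit W n a y)
      ((hsum K).mul_left C) Metric.isOpen_ball
      (convex_ball 0 R).isPreconnected ?_ ?_ ?_ ?_ ?_
    · intro n y _
      have hc : Continuous (fun y => W a y * pit W n a y) := (sec _ a hW).mul (sec _ a (hcp n))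
      exact intervalIntegral.integral_hasDerivAt_right
        (hc.intervalIntegrable _ _)
        (hc.stronglyMeasurableAtFilter _ _) hc.continuousAt
    · intro n y hy
      rw [mem_ball_zero_iff] at hy
      exact (h a y (le_max_left _ _) hy.le n).2.2
    · rw [mem_ball_zero_iff, norm_zero]; linarith
    · simp [hq0, summable_zero]
    · rw [mem_ball_zero_iff, Real.norm_eq_abs]; linarith
  · intro a
    simp [hF1, hp0]
  · intro a
    simp [hq0]
  · intro a x
    simp only [(pq_even hE _ a).1]


/-- mean value inequality, lower form -/
lemma mv_le {f f' : ℝ → ℝ} (hf : ∀ x, HasDerivAt f (f' x) x) {a b m : ℝ} (hab : a ≤ b)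
    (hm : ∀ x, a ≤ x → x ≤ b → m ≤ f' x) : m * (b - a) ≤ f b - f a := by
  refine (convex_Icc a b).mul_sub_le_image_sub_of_le_deriv
    (fun x _ => (hf x).continuousAt.continuousWithinAt)
    (fun x _ => (hf x).differentiableAt.differentiableWithinAt) ?_ a ⟨le_rfl, hab⟩ b ⟨hab, le_rfl⟩ hab
  intro x hx
  rw [interior_Icc] at hx
  rw [(hf x).deriv]
  exact hm x hx.1.le hx.2.le

/-- mean value inequality, upper form -/
lemma mv_ge {f f' : ℝ → ℝ} (hf : ∀ x, HasDerivAt f (f' x) x) {a b m : ℝ} (hab : a ≤ b)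
    (hm : ∀ x, a ≤ x → x ≤ b → f' x ≤ m) : f b - f a ≤ m * (b - a) := by
  have := mv_le (f := fun x => - f x) (f' := fun x => - f' x) (m := -m) (fun x => (hf x).neg) hab
    (fun x h1 h2 => by have := hm x h1 h2; linarith)
  linarith

/-- If `F F' > 0` (or `F F' = 0` at the start) and the potential is nonnegative after `x`,
then `F ^ 2` grows and `F` stays positive. -/
lemma stay_pos {F G w : ℝ → ℝ} (hF : ∀ x, HasDerivAt F (G x) x)
    (hG : ∀ x, HasDerivAt G (w x * F x) x) {x : ℝ} (hw : ∀ y, x ≤ y → 0 ≤ w y)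
    (hx : 0 < F x) (hx' : 0 ≤ G x) : ∀ y, x ≤ y → 0 < F y := by
  have h1 : ∀ y, HasDerivAt (fun y => F y * G y) (G y * G y + F y * (w y * F y)) y :=
    fun y => (hF y).mul (hG y)
  have h2 : ∀ y, x ≤ y → 0 ≤ F y * G y := by
    intro y hy
    have := mv_le h1 (m := 0) hy (fun z hz _ => by nlinarith [hw z hz, mul_self_nonneg (G z), mul_nonneg (hw z hz) (mul_self_nonneg (F z))])
    have := mul_nonneg hx.le hx'
    linarith
  have h3 : ∀ y, HasDerivAt (fun y => F y * F y) (G y * F y + F y * G y) y :=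
    fun y => (hF y).mul (hF y)
  have h4 : ∀ y, x ≤ y → F x * F x ≤ F y * F y := by
    intro y hy
    have := mv_le h3 (m := 0) hy (fun z hz _ => by nlinarith [h2 z hz])
    linarith
  intro y hy
  by_contra hn
  push Not at hn
  have hc : ContinuousOn F (Set.Icc x y) := fun z _ => (hF z).continuousAt.continuousWithinAt
  obtain ⟨z, hz, hz0⟩ := intermediate_value_Icc' hy hc (show (0:ℝ) ∈ Set.Icc (F y) (F x) from ⟨hn, hx.le⟩)
  have := h4 z hz.1
  rw [hz0] at this
  nlinarith

/-- A nonnegative potential region yields: bounded derivative of positive decaying solutions. -/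
lemma deriv_bdd {F G w : ℝ → ℝ} (hF : ∀ x, HasDerivAt F (G x) x)
    (hG : ∀ x, HasDerivAt G (w x * F x) x) {x : ℝ} (hw : ∀ y, x ≤ y → 0 ≤ w y)
    (hpos : ∀ y, 0 < F y) (hlim : Tendsto F atTop (𝓝 0)) :
    ∀ y, x ≤ y → |G y| ≤ |G x| := by
  have hmono : ∀ y z, x ≤ y → y ≤ z → G y ≤ G z := by
    intro y z hy hz
    have := mv_le hG (m := 0) hz (fun u hu _ => mul_nonneg (hw u (hy.trans hu)) (hpos u).le)
    linarith
  intro y hy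
  have hneg : G y ≤ 0 := by
    by_contra hn
    push Not at hn
    have h1 : ∀ z, y ≤ z → F y ≤ F z := by
      intro z hz
      have := mv_le hF (m := 0) hz (fun u hu _ => hn.le.trans (hmono y u hy hu))
      linarith
    have := ge_of_tendsto hlim ((eventually_ge_atTop y).mono h1)
    linarith [hpos y]
  have := hmono x y le_rfl hy
  rw [abs_of_nonpos hneg, abs_of_nonpos (this.trans hneg)]
  linarith

/-- The Wronskian argument. -/
lemma uniq_aux {V : ℝ → ℝ} {Vbar g1 g2 : ℝ} (hVlim : Tendsto V atTop (𝓝 Vbar))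
    (hg1 : g1 < Vbar) (hg2 : g2 < Vbar) (hlt : g1 < g2) {F1 G1 F2 G2 : ℝ → ℝ}
    (hF1 : ∀ x, HasDerivAt F1 (G1 x) x) (hG1 : ∀ x, HasDerivAt G1 ((V x - g1) * F1 x) x)
    (hF2 : ∀ x, HasDerivAt F2 (G2 x) x) (hG2 : ∀ x, HasDerivAt G2 ((V x - g2) * F2 x) x)
    (p1 : ∀ x, 0 < F1 x) (p2 : ∀ x, 0 < F2 x) (z1 : G1 0 = 0) (z2 : G2 0 = 0)
    (l1 : Tendsto F1 atTop (𝓝 0)) (l2 : Tendsto F2 atTop (𝓝 0)) : False := by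
  have hw : ∀ x, HasDerivAt (fun x => G1 x * F2 x - F1 x * G2 x) ((g2 - g1) * (F1 x * F2 x)) x := by
    intro x
    refine (((hG1 x).mul (hF2 x)).sub ((hF1 x).mul (hG2 x))).congr_deriv ?_
    ring
  have hmono : StrictMono (fun x => G1 x * F2 x - F1 x * G2 x) := by
    refine strictMono_of_deriv_pos fun x => ?_
    rw [(hw x).deriv]
    exact mul_pos (by linarith) (mul_pos (p1 x) (p2 x))
  have hone : 0 < G1 1 * F2 1 - F1 1 * G2 1 := by
    have := hmono (show (0:ℝ) < 1 by norm_num)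
    simpa [z1, z2] using this
  obtain ⟨X, hX⟩ := eventually_atTop.1 (hVlim.eventually (lt_mem_nhds (max_lt hg1 hg2)))
  have b1 := deriv_bdd (x := X) hF1 hG1 (fun y hy => by
    have := (le_max_left g1 g2).trans_lt (hX y hy); linarith) p1 l1
  have b2 := deriv_bdd (x := X) hF2 hG2 (fun y hy => by
    have := (le_max_right g1 g2).trans_lt (hX y hy); linarith) p2 l2
  have hl : Tendsto (fun x => |G1 X| * F2 x + F1 x * |G2 X|) atTop (𝓝 0) := by
    simpa using (l2.const_mul |G1 X|).add (l1.mul_const |G2 X|)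
  have hge : ∀ᶠ x in atTop, G1 1 * F2 1 - F1 1 * G2 1 ≤ |G1 X| * F2 x + F1 x * |G2 X| := by
    filter_upwards [eventually_ge_atTop X, eventually_ge_atTop 1] with x hx hx1
    have h1 := hmono.monotone hx1
    have h2 := mul_le_mul_of_nonneg_right ((le_abs_self _).trans (b1 x hx)) (p2 x).le
    have h3 := mul_le_mul_of_nonneg_left ((neg_le_abs _).trans (b2 x hx)) (p1 x).le
    linarith
  have := ge_of_tendsto hl hge
  linarith

/-- A solution with vanishing Cauchy data at a point `x ≥ 0` has vanishing data at `0`. -/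
lemma cauchy_zero {F G w : ℝ → ℝ} (hwc : Continuous w) (hF : ∀ x, HasDerivAt F (G x) x)
    (hG : ∀ x, HasDerivAt G (w x * F x) x) {x : ℝ} (hx : 0 ≤ x) (h1 : F x = 0) (h2 : G x = 0) :
    F 0 = 0 := by
  obtain ⟨M, hM⟩ := (isCompact_Icc (a := 0) (b := x)).exists_bound_of_continuousOn hwc.continuousOn
  have hd : ∀ y, HasDerivAt (fun y => (F y * F y + G y * G y) * Real.exp ((1 + M) * y))
      (((G y * F y + F y * G y) + (w y * F y * G y + G y * (w y * F y))) * Real.exp ((1 + M) * y)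
        + (F y * F y + G y * G y) * (Real.exp ((1 + M) * y) * ((1 + M) * 1))) y := fun y =>
    (((hF y).mul (hF y)).add ((hG y).mul (hG y))).mul
      (((hasDerivAt_id y).const_mul (1 + M)).exp)
  have := mv_le hd (m := 0) hx (fun y hy hyx => by
    have hwy := abs_le.1 (hM y ⟨hy, hyx⟩)
    have he := Real.exp_pos ((1 + M) * y)
    have : 0 ≤ ((G y * F y + F y * G y) + (w y * F y * G y + G y * (w y * F y)))
        + (F y * F y + G y * G y) * (1 + M) := by
      have e1 : 0 ≤ (M + w y) * (F y + G y) ^ 2 := mul_nonneg (by linarith) (sq_nonneg _)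
      have e2 : 0 ≤ (M - w y) * (F y - G y) ^ 2 := mul_nonneg (by linarith) (sq_nonneg _)
      nlinarith [sq_nonneg (F y + G y)]
    have := mul_nonneg this he.le
    linarith)
  simp only [h1, h2, mul_zero, Real.exp_zero] at this
  nlinarith [mul_self_nonneg (F 0), mul_self_nonneg (G 0)]

/-- Bilateral case, spectral parameter: for `V` continuous, even, nondecreasing on `[0,∞)`,
converging to `V̄` at `+∞` with `V(0) < V̄`, there is a unique `γ₀ ∈ (V(0), V̄)` such that
the equation `φ'' = (V-γ₀)φ` admits an even positive `C²` solution vanishing at `+∞`. -/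
theorem bilateral_spectral_parameter_exists_unique
    (V : ℝ → ℝ) (Vbar : ℝ)
    (hVc : Continuous V) (hVeven : ∀ x, V (-x) = V x)
    (hVmono : MonotoneOn V (Set.Ici 0))
    (hVlim : Tendsto V atTop (𝓝 Vbar))
    (hVlt : V 0 < Vbar) :
    ∃! γ : ℝ, γ ∈ Set.Ioo (V 0) Vbar ∧
      ∃ φ : ℝ → ℝ, (∀ x, 0 < φ x) ∧ ContDiff ℝ 2 φ ∧
        (∀ x, φ (-x) = φ x) ∧
        (∀ x, deriv (deriv φ) x = (V x - γ) * φ x) ∧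
        Tendsto φ atTop (𝓝 0) := by
  obtain ⟨F, G, hFc, hGc, hF, hG, hF0, hG0, hFe⟩ := exists_flow (W := fun a x => V x - a)
    ((hVc.comp continuous_snd).sub continuous_fst) (fun a x => by simp only [hVeven])
  have hVle : ∀ x, 0 ≤ x → V x ≤ Vbar := fun x hx =>
    ge_of_tendsto hVlim ((eventually_ge_atTop x).mono fun y hy => hVmono hx (hx.trans hy) hy)
  have hV0 : ∀ x, 0 ≤ x → V 0 ≤ V x := fun x hx => hVmono (Set.mem_Ici.2 le_rfl) hx hx
  let A : Set ℝ := {g | ∃ x, 0 ≤ x ∧ F g x < 0}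
  let B : Set ℝ := {g | ∃ x, 0 ≤ x ∧ 0 < G g x ∧ ∀ y ∈ Set.Icc 0 x, 0 < F g y}
  have secF : ∀ x, Continuous (fun g => F g x) := fun x =>
    hFc.comp (continuous_id.prodMk continuous_const)
  have secG : ∀ x, Continuous (fun g => G g x) := fun x =>
    hGc.comp (continuous_id.prodMk continuous_const)
  have hA : IsOpen A := by
    rw [isOpen_iff_mem_nhds]
    rintro g ⟨x, hx, hxF⟩
    filter_upwards [(secF x).continuousAt.eventually (gt_mem_nhds hxF)] with g' hg'
    exact ⟨x, hx, hg'⟩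
  have hB : IsOpen B := by
    rw [isOpen_iff_mem_nhds]
    rintro g ⟨x, hx, hxG, hxF⟩
    have h2 : ∀ᶠ g' in 𝓝 g, ∀ y ∈ Set.Icc 0 x, 0 < F g' y := by
      refine isCompact_Icc.eventually_forall_of_forall_eventually ?_
      intro y hy
      exact hFc.continuousAt.eventually (lt_mem_nhds (hxF y hy))
    filter_upwards [(secG x).continuousAt.eventually (lt_mem_nhds hxG), h2] with g' h1 h2
    exact ⟨x, hx, h1, h2⟩
  have hAB : ∀ g, g ∈ A → g ∈ B → False := by
    rintro g ⟨x, hx, hxF⟩ ⟨y, hy, hyG, hyF⟩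
    have hVy : g < V y := by
      by_contra hn
      push Not at hn
      have := mv_ge (hG g) (m := 0) hy (fun z hz hzy => by
        have h1 := hVmono hz hy hzy
        have h2 := hyF z ⟨hz, hzy⟩
        exact mul_nonpos_of_nonpos_of_nonneg (by linarith) h2.le)
      rw [hG0] at this
      linarith
    rcases le_total x y with h | h
    · exact absurd hxF (hyF x ⟨hx, h⟩).not_gt
    · have := stay_pos (hF g) (hG g) (x := y) (fun z hz => by
        have := hVmono hy (hy.trans hz) hz
        linarith) (hyF y ⟨hy, le_rfl⟩) hyG.le x h
      linarith
  have hVbarA : Vbar ∈ A := by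
    by_contra hn
    have hnn : ∀ x, 0 ≤ x → 0 ≤ F Vbar x := by
      intro x hx
      by_contra h
      exact hn ⟨x, hx, not_le.1 h⟩
    have hanti : ∀ x y, 0 ≤ x → x ≤ y → G Vbar y ≤ G Vbar x := by
      intro x y hx hxy
      have := mv_ge (hG Vbar) (m := 0) hxy (fun z hz _ =>
        mul_nonpos_of_nonpos_of_nonneg (by linarith [hVle z (hx.trans hz)]) (hnn z (hx.trans hz)))
      linarith
    have hGz : ∀ x, 0 ≤ x → G Vbar x = 0 := by
      intro x hx
      have hle : G Vbar x ≤ 0 := by simpa [hG0] using hanti 0 x le_rfl hx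
      by_contra hne
      have hlt : G Vbar x < 0 := lt_of_le_of_ne hle hne
      set d := (F Vbar x + 1) / (- G Vbar x) with hd
      have hdpos : 0 ≤ d := div_nonneg (by linarith [hnn x hx]) (by linarith)
      have h1 := mv_ge (hF Vbar) (a := x) (b := x + d) (m := G Vbar x) (by linarith)
        (fun z hz _ => hanti x z hx hz)
      have h2 : G Vbar x * (x + d - x) = -(F Vbar x + 1) := by
        rw [hd]; field_simp; ring
      have h3 := hnn (x + d) (by linarith)
      linarith
    have h1 : HasDerivWithinAt (G Vbar) ((V 0 - Vbar) * F Vbar 0) (Set.Ici 0) 0 :=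
      (hG Vbar 0).hasDerivWithinAt
    have h2 : HasDerivWithinAt (G Vbar) 0 (Set.Ici 0) 0 :=
      (hasDerivWithinAt_const (0:ℝ) (Set.Ici 0) (0:ℝ)).congr (fun x hx => hGz x hx) (hGz 0 le_rfl)
    have h3 := (uniqueDiffOn_Ici (0:ℝ) 0 Set.self_mem_Ici).eq_deriv _ h1 h2
    rw [hF0] at h3
    linarith
  have hV0B : V 0 ∈ B := by
    have hpos : ∀ x, 0 ≤ x → 0 < F (V 0) x :=
      stay_pos (hF (V 0)) (hG (V 0)) (x := 0) (fun z hz => by linarith [hV0 z hz])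
        (by rw [hF0]; norm_num) (by rw [hG0])
    by_contra hn
    have hGz : ∀ x, 0 ≤ x → G (V 0) x = 0 := by
      intro x hx
      refine le_antisymm ?_ ?_
      · by_contra h
        exact hn ⟨x, hx, not_le.1 h, fun y hy => hpos y hy.1⟩
      · have := mv_le (hG (V 0)) (m := 0) hx (fun z hz _ =>
          mul_nonneg (by linarith [hV0 z hz]) (hpos z hz).le)
        rw [hG0] at this
        linarith
    obtain ⟨x, hxV, hx0⟩ := ((hVlim.eventually (lt_mem_nhds hVlt)).and
      (eventually_gt_atTop (0:ℝ))).exists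
    have h2 : HasDerivAt (G (V 0)) 0 x :=
      (hasDerivAt_const x (0:ℝ)).congr_of_eventuallyEq
        ((lt_mem_nhds hx0).mono fun y hy => hGz y (le_of_lt hy))
    have h3 := (hG (V 0) x).unique h2
    have := mul_pos (sub_pos.2 hxV) (hpos x hx0.le)
    linarith
  obtain ⟨g, hg, hgA, hgB⟩ : ∃ g ∈ Set.Icc (V 0) Vbar, g ∉ A ∧ g ∉ B := by
    by_contra! hn
    obtain ⟨z, _, hz1, hz2⟩ := isPreconnected_Icc (a := V 0) (b := Vbar) A B hA hB
      (fun g hg => by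
        by_cases h : g ∈ A
        · exact Or.inl h
        · exact Or.inr (hn g hg h))
      ⟨Vbar, ⟨hVlt.le, le_rfl⟩, hVbarA⟩ ⟨V 0, ⟨le_rfl, hVlt.le⟩, hV0B⟩
    exact hAB z hz1 hz2
  have hg1 : V 0 < g := lt_of_le_of_ne hg.1 (fun h => hgB (h ▸ hV0B))
  have hg2 : g < Vbar := lt_of_le_of_ne hg.2 (fun h => hgA (h ▸ hVbarA))
  have hnn : ∀ x, 0 ≤ x → 0 ≤ F g x := by
    intro x hx
    by_contra h
    exact hgA ⟨x, hx, not_le.1 h⟩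
  have hpos : ∀ x, 0 ≤ x → 0 < F g x := by
    intro x hx
    refine lt_of_le_of_ne (hnn x hx) (fun h0 => ?_)
    have hx0 : 0 < x := by
      refine lt_of_le_of_ne hx (fun h => ?_)
      rw [← h, hF0] at h0
      norm_num at h0
    have hmin : IsLocalMin (F g) x := by
      filter_upwards [lt_mem_nhds hx0] with y hy
      rw [← h0]
      exact hnn y (le_of_lt hy)
    have hGx := hmin.hasDerivAt_eq_zero (hF g x)
    have := cauchy_zero (hVc.sub continuous_const) (hF g) (hG g) hx h0.symm hGx
    rw [hF0] at this
    norm_num at this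
  have hGle : ∀ x, 0 ≤ x → G g x ≤ 0 := by
    intro x hx
    by_contra h
    exact hgB ⟨x, hx, not_le.1 h, fun y hy => hpos y hy.1⟩
  have hanti : ∀ x y, 0 ≤ x → x ≤ y → F g y ≤ F g x := by
    intro x y hx hxy
    have := mv_ge (hF g) (m := 0) hxy (fun z hz _ => hGle z (hx.trans hz))
    linarith
  have hlim : Tendsto (F g) atTop (𝓝 0) := by
    have hsmall : ∀ ε > 0, ∃ x, 0 ≤ x ∧ F g x < ε := by
      intro ε hε
      by_contra! hn
      obtain ⟨X, hX⟩ := eventually_atTop.1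
        (hVlim.eventually (lt_mem_nhds (show (g + Vbar) / 2 < Vbar by linarith)))
      set Y := max X 0 with hY
      have hY0 : 0 ≤ Y := le_max_right _ _
      have hYX : X ≤ Y := le_max_left _ _
      set c := (Vbar - g) / 2 * ε with hc
      have hcpos : 0 < c := mul_pos (by linarith) hε
      set d := (1 - G g Y) / c with hd
      have hdpos : 0 ≤ d := div_nonneg (by linarith [hGle Y hY0]) hcpos.le
      have h1 := mv_le (hG g) (a := Y) (b := Y + d) (m := c) (by linarith) (fun z hz _ => by
        have h1 := hX z (hYX.trans hz)
        exact mul_le_mul (by linarith) (hn z (hY0.trans hz)) hε.le (by linarith))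
      have h2 : c * (Y + d - Y) = 1 - G g Y := by
        rw [hd]; field_simp; ring
      have h3 := hGle (Y + d) (by linarith)
      linarith
    rw [Metric.tendsto_atTop]
    intro ε hε
    obtain ⟨x, hx, hxε⟩ := hsmall ε hε
    refine ⟨x, fun y hy => ?_⟩
    rw [Real.dist_eq, sub_zero, abs_of_pos (hpos y (hx.trans hy))]
    exact (hanti x y hx hy).trans_lt hxε
  have hposall : ∀ x, 0 < F g x := by
    intro x
    rcases le_total 0 x with h | h
    · exact hpos x h
    · rw [← hFe]; exact hpos (-x) (by linarith)
  have hdF : deriv (F g) = G g := funext fun x => (hF g x).deriv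
  have hdG : deriv (G g) = fun x => (V x - g) * F g x := funext fun x => (hG g x).deriv
  have hFcg : Continuous (F g) :=
    continuous_iff_continuousAt.2 fun x => (hF g x).continuousAt
  refine ⟨g, ⟨⟨hg1, hg2⟩, F g, hposall, ?_, hFe g, ?_, hlim⟩, ?_⟩
  · rw [show (2 : WithTop ℕ∞) = 1 + 1 from by norm_num, contDiff_succ_iff_deriv, hdF,
      contDiff_one_iff_deriv, hdG]
    refine ⟨fun x => (hF g x).differentiableAt, by simp, fun x => (hG g x).differentiableAt, ?_⟩
    exact (hVc.sub continuous_const).mul hFcg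
  · intro x
    rw [hdF, hdG]
  · rintro g' ⟨⟨_, hg'2⟩, φ, φpos, φC, φe, φeq, φlim⟩
    have hφ : ∀ x, HasDerivAt φ (deriv φ x) x := fun x =>
      (φC.differentiable (by norm_num) x).hasDerivAt
    have hφ' : ∀ x, HasDerivAt (deriv φ) ((V x - g') * φ x) x := by
      intro x
      rw [← φeq]
      have : ContDiff ℝ (1 + 1) φ := by
        rw [show (1 + 1 : WithTop ℕ∞) = 2 from by norm_num]; exact φC
      exact ((contDiff_succ_iff_deriv.1 this).2.2.differentiable (by norm_num) x).hasDerivAt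
    have hφ0 : deriv φ 0 = 0 := by
      have h1 : HasDerivAt (fun x => φ (-x)) (-deriv φ 0) 0 := by
        have h0 : HasDerivAt φ (deriv φ 0) (-(0:ℝ)) := by simpa using hφ 0
        have := HasDerivAt.comp (0:ℝ) h0 (hasDerivAt_neg (0:ℝ))
        simpa [Function.comp_def] using this
      simp only [φe] at h1
      have := h1.unique (hφ 0)
      linarith
    rcases lt_trichotomy g' g with h | h | h
    · exact (uniq_aux hVlim hg'2 hg2 h hφ hφ' (hF g) (hG g) φpos hposall hφ0 (hG0 g)
        φlim hlim).elim
    · exact h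
    · exact (uniq_aux hVlim hg2 hg'2 h (hF g) (hG g) hφ hφ' hposall φpos (hG0 g) hφ0
        hlim φlim).elim
end
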